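/- There exist β_l > 0 and δ > 0 such that for every β ≥ β_l and every translation invariant, spin-flip symmetric interaction Ψ on Ω = {1,-1}^{Z^d} with |||Ψ||| < δ, the interaction Φ = Φ^β + Ψ has at least two distinct translation-invariant Gibbs states (equivalently, more than one equilibrium state). -/

import Mathlib

open scoped BigOperators
open Real MeasureTheory Filter Topology

namespace Ising

/-- The lattice `ℤ^d`. -/
abbrev V (d : ℕ) := Fin d → ℤ
/-- Spin configurations on `ℤ^d`; `true` encodes spin `+1`, `false` encodes spin `-1`. -/
abbrev Config (d : ℕ) := V d → Bool
/-- The ambient euclidean space `ℝ^d`. -/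
abbrev Point (d : ℕ) := Fin d → ℝ

variable {d : ℕ}

noncomputable section

/-- The spin value (`±1`) of a boolean. -/
def spin (b : Bool) : ℝ := if b then 1 else -1

/-- An interaction assigns to each finite `Λ ⊆ ℤ^d` a function of configurations
(only the restriction to `Λ` is relevant; see `IsLocal`). -/
abbrev Interaction (d : ℕ) := Finset (V d) → Config d → ℝ

/-- `Φ_Λ` depends only on the restriction of the configuration to `Λ`. -/
def IsLocal (Φ : Interaction d) : Prop :=
  ∀ (Λ : Finset (V d)) (ω ω' : Config d), (∀ x ∈ Λ, ω x = ω' x) → Φ Λ ω = Φ Λ ω'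

/-- Translation of a configuration: `(τ^a ω)(x) = ω(x+a)`. -/
def translate (a : V d) (ω : Config d) : Config d := fun x => ω (x + a)

/-- Translation invariance of an interaction: `Φ_Λ(ω) = Φ_{Λ-a}(τ^a ω)`. -/
def TransInv (Φ : Interaction d) : Prop :=
  ∀ (a : V d) (Λ : Finset (V d)) (ω : Config d),
    Φ (Λ.image (fun x => x - a)) (translate a ω) = Φ Λ ω

/-- Spin-flip symmetry: `Ψ_Λ(ω) = Ψ_Λ(-ω)`. -/
def SpinFlipSymm (Ψ : Interaction d) : Prop :=
  ∀ (Λ : Finset (V d)) (ω : Config d), Ψ Λ (fun x => !(ω x)) = Ψ Λ ω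

/-- `sup_{ω ∈ Ω_Λ} |Φ_Λ(ω)|`. -/
def supNorm (Φ : Interaction d) (Λ : Finset (V d)) : ℝ := ⨆ ω : Config d, |Φ Λ ω|

/-- The summand of the norm `‖Φ‖`. -/
def normTerm (Φ : Interaction d) (Λ : Finset (V d)) : ℝ :=
  if (0 : V d) ∈ Λ then supNorm Φ Λ else 0

/-- `‖Φ‖ = Σ_{0 ∈ Λ ⋐ ℤ^d} sup_{ω} |Φ_Λ(ω)|`. -/
def anorm (Φ : Interaction d) : ℝ := ∑' Λ : Finset (V d), normTerm Φ Λ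

/-- Absolute summability of an interaction. -/
def AbsSummable (Φ : Interaction d) : Prop := Summable (normTerm Φ)

/-- `‖x-y‖_∞`. -/
def distInf (x y : V d) : ℕ := Finset.univ.sup fun i => (x i - y i).natAbs

/-- `‖x-y‖_1`. -/
def dist1 (x y : V d) : ℕ := ∑ i, (x i - y i).natAbs

/-- `diam(Λ) = sup {‖x-y‖_∞ : x, y ∈ Λ}`. -/
def diam (Λ : Finset (V d)) : ℕ := Λ.sup fun x => Λ.sup fun y => distInf x y

/-- The summand of the `d`-th order decaying norm `|||Ψ|||`. -/
def dTerm (Ψ : Interaction d) (Λ : Finset (V d)) : ℝ :=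
  if (0 : V d) ∈ Λ then ((diam Λ + 1 : ℕ) : ℝ) ^ d * supNorm Ψ Λ else 0

/-- `|||Ψ||| = Σ_{0 ∈ Λ ⋐ ℤ^d} (diam(Λ)+1)^d sup_{ω} |Ψ_Λ(ω)|`. -/
def dnorm (Ψ : Interaction d) : ℝ := ∑' Λ : Finset (V d), dTerm Ψ Λ

/-- Summability of the `d`-th order decaying norm. -/
def DSummable (Ψ : Interaction d) : Prop := Summable (dTerm Ψ)

/-- The summand of the norm `|||Ψ|||'`. -/
def dTerm' (Ψ : Interaction d) (Λ : Finset (V d)) : ℝ :=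
  if (0 : V d) ∈ Λ then (Λ.card : ℝ)⁻¹ * ((diam Λ + 1 : ℕ) : ℝ) ^ d * supNorm Ψ Λ else 0

/-- `|||Ψ|||' = Σ_{0 ∈ Λ ⋐ ℤ^d} |Λ|⁻¹ (diam(Λ)+1)^d sup_{ω} |Ψ_Λ(ω)|`. -/
def dnorm' (Ψ : Interaction d) : ℝ := ∑' Λ : Finset (V d), dTerm' Ψ Λ

/-- Summability of the norm `|||·|||'`. -/
def DSummable' (Ψ : Interaction d) : Prop := Summable (dTerm' Ψ)

/-- The Hamiltonian `H_{Φ,Λ}(ω) = Σ_{Δ ⋐ ℤ^d, Δ ∩ Λ ≠ ∅} Φ_Δ(ω|_Δ)`. -/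
def ham (Φ : Interaction d) (Λ : Finset (V d)) (ω : Config d) : ℝ :=
  ∑' Δ : Finset (V d), if (Δ ∩ Λ).Nonempty then Φ Δ ω else 0

/-- The configuration `ω_Λ ∨ η` agreeing with `f` on `Λ` and with `η` off `Λ`. -/
def fill (Λ : Finset (V d)) (f : ↥Λ → Bool) (η : Config d) : Config d :=
  fun x => if h : x ∈ Λ then f ⟨x, h⟩ else η x

/-- The partition function `Z^η_{Φ,Λ}`. -/
def gibbsZ (Φ : Interaction d) (Λ : Finset (V d)) (η : Config d) : ℝ :=
  ∑ f : ↥Λ → Bool, Real.exp (-(ham Φ Λ (fill Λ f η)))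

/-- The finite Gibbs state `μ^η_{Φ,Λ}({ω_Λ})`. -/
def finGibbs (Φ : Interaction d) (Λ : Finset (V d)) (η : Config d) (f : ↥Λ → Bool) : ℝ :=
  Real.exp (-(ham Φ Λ (fill Λ f η))) / gibbsZ Φ Λ η

/-- The cylinder set `{ξ : ξ|_Λ = f}`. -/
def cyl (Λ : Finset (V d)) (f : ↥Λ → Bool) : Set (Config d) :=
  {ξ | ∀ (x : V d) (h : x ∈ Λ), ξ x = f ⟨x, h⟩}

/-- `σ` is a Gibbs state for `Φ` (DLR condition): for each finite `Λ` there is a Borel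
probability measure on boundary conditions with respect to which `σ` of each cylinder
is the average of the finite Gibbs states. -/
def IsGibbs (Φ : Interaction d) (σ : Measure (Config d)) : Prop :=
  IsProbabilityMeasure σ ∧
  ∀ Λ : Finset (V d), ∃ ν : Measure (Config d), IsProbabilityMeasure ν ∧
    ∀ f : ↥Λ → Bool, (σ (cyl Λ f)).toReal = ∫ η, finGibbs Φ Λ η f ∂ν

/-- Translation invariance of a measure: `τ^a_* σ = σ`. -/
def MeasTransInv (σ : Measure (Config d)) : Prop :=
  ∀ a : V d, σ.map (translate a) = σ

/-- The Ising interaction at inverse temperature `β`: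
`Φ^β_Λ(ω) = -β ω(x) ω(y)` if `Λ = {x,y}` with `‖x-y‖₁ = 1`, and `0` otherwise. -/
def ising (β : ℝ) : Interaction d := fun Λ ω =>
  if Λ.card = 2 ∧ ∀ x ∈ Λ, ∀ y ∈ Λ, x ≠ y → dist1 x y = 1
  then -β * ∏ x ∈ Λ, spin (ω x) else 0

/-- The sum of two interactions. -/
def Iadd (Φ Ψ : Interaction d) : Interaction d := fun Λ ω => Φ Λ ω + Ψ Λ ω

/-- `S` is connected for the adjacency given by `ρ`-distance `1`. -/
def ConnectedBy (ρ : V d → V d → ℕ) (S : Set (V d)) : Prop :=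
  ∀ x ∈ S, ∀ y ∈ S, ∃ (n : ℕ) (p : ℕ → V d), p 0 = x ∧ p n = y ∧
    (∀ i ≤ n, p i ∈ S) ∧ ∀ i < n, ρ (p i) (p (i+1)) = 1

/-- `‖·‖₁`-connectedness. -/
def Conn1 (S : Set (V d)) : Prop := ConnectedBy dist1 S

/-- `‖·‖_∞`-connectedness. -/
def ConnInf (S : Set (V d)) : Prop := ConnectedBy distInf S

/-- A finite set `Λ` is c-connected if both `Λ` and its complement are `‖·‖_∞`-connected. -/
def CConn (Λ : Finset (V d)) : Prop :=
  ConnInf (↑Λ : Set (V d)) ∧ ConnInf ((↑Λ : Set (V d))ᶜ)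

/-- `Ψ` vanishes on sets that are not `‖·‖₁`-connected. -/
def ZeroOnNonConn (Ψ : Interaction d) : Prop :=
  ∀ Λ : Finset (V d), ¬ Conn1 (↑Λ : Set (V d)) → ∀ ω, Ψ Λ ω = 0

/-- The closed unit cube `I_x` centered at `x ∈ ℤ^d`. -/
def cube (x : V d) : Set (Point d) := {y | ∀ i, |y i - (x i : ℝ)| ≤ 1/2}

/-- `M(S) = ⋃_{x ∈ S} I_x`. -/
def cubes (S : Set (V d)) : Set (Point d) := ⋃ x ∈ S, cube x

/-- A contour is the boundary `∂M(S)` of `M(S)` for a finite c-connected `S`. -/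
def IsContour (γ : Set (Point d)) : Prop :=
  ∃ S : Finset (V d), CConn S ∧ γ = frontier (cubes ↑S)

/-- The set of sites with spin `-1`. -/
def minusSet (ω : Config d) : Set (V d) := {x | ω x = false}

/-- `Γ(ω)`: the connected components of `∂M({x : ω(x) = -1})`. -/
def Gamma (ω : Config d) : Set (Set (Point d)) :=
  {γ | ∃ y ∈ frontier (cubes (minusSet ω)),
    γ = connectedComponentIn (frontier (cubes (minusSet ω))) y}

/-- The `(d-1)`-dimensional face of the unit cubes lying between `x` and `x + e_i`. -/
def face (x : V d) (i : Fin d) : Set (Point d) :=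
  {y | y i = (x i : ℝ) + 1/2 ∧ ∀ j, j ≠ i → |y j - (x j : ℝ)| ≤ 1/2}

/-- A plaquette is a `(d-1)`-dimensional face of one of the cubes `I_x`. -/
def IsPlaquette (P : Set (Point d)) : Prop := ∃ x i, P = face x i

/-- `|γ|`: the number of plaquettes contained in `γ`. -/
def csize (γ : Set (Point d)) : ℕ :=
  Nat.card {P : Set (Point d) // IsPlaquette P ∧ P ⊆ γ}

/-- The constant `+1` configuration. -/
def plusC : Config d := fun _ => true

/-- The constant `-1` configuration. -/
def minusC : Config d := fun _ => false

open scoped Classical in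
/-- The finite-volume Gibbs probability (with boundary condition `η`) of an event
`A`: `μ^η_{Φ,Λ}({ω : ω ∨ η ∈ A})`. -/
def bcProb (Φ : Interaction d) (Λ : Finset (V d)) (η : Config d) (A : Set (Config d)) : ℝ :=
  (∑ f : ↥Λ → Bool, if fill Λ f η ∈ A then Real.exp (-(ham Φ Λ (fill Λ f η))) else 0) /
    gibbsZ Φ Λ η

/-- `ω ∈ Ω_Λ^+`, i.e. `ω` is `+1` off `Λ`. -/
def plusOutside (Λ : Finset (V d)) (ω : Config d) : Prop := ∀ x, x ∉ Λ → ω x = true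

/-- The configuration obtained by flipping all spins in `S`. -/
def flipOn (S : Finset (V d)) (ω : Config d) : Config d :=
  fun x => if x ∈ S then !(ω x) else ω x

/-- `|𝓔_Λ|`: the number of nearest-neighbour edges meeting `Λ`. -/
def edgeCount (Λ : Finset (V d)) : ℕ :=
  Nat.card {e : Finset (V d) // (∃ x y, e = {x, y} ∧ dist1 x y = 1) ∧ (e ∩ Λ).Nonempty}

/-- `R` is a (nonempty) rectangle in `ℤ^d`. -/
def IsRect (R : Finset (V d)) : Prop := ∃ a b : V d, a ≤ b ∧ R = Finset.Icc a b

/-- `R(Λ)`: the minimal rectangle containing `Λ`. -/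
def minRect (Λ : Finset (V d)) : Finset (V d) :=
  if h : Λ.Nonempty then
    Finset.Icc (fun i => Λ.inf' h fun x => x i) (fun i => Λ.sup' h fun x => x i)
  else ∅

open scoped Classical in
/-- The rectangle regrouping `Ψ̃` of `Ψ`: `Ψ̃_R(ω) = Σ_{Λ : R(Λ) = R} Ψ_Λ(ω|_Λ)` for
rectangles `R`, and `Ψ̃_Λ = 0` for non-rectangles. -/
def regroup (Ψ : Interaction d) : Interaction d := fun R ω =>
  if IsRect R then ∑ Λ ∈ R.powerset, (if minRect Λ = R then Ψ Λ ω else 0) else 0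


/-! ### Part 1: counting connected sets by walks -/

section Walks
variable {E St : Type} [DecidableEq E]

/-- Vertices visited by the walk from `e` with steps `l`. -/
def visited (step : E → St → E) : E → List St → Finset E
  | e, [] => {e}
  | e, s :: l => insert e (visited step (step e s) l)

lemma mem_visited_start (step : E → St → E) (e : E) (l : List St) : e ∈ visited step e l := by
  cases l <;> simp [visited]

lemma visited_splice (step : E → St → E) (b a : E) (s s' : St) (h1 : step b s = a)
    (h2 : step a s' = b) (l : List St) : ∀ e, b ∈ visited step e l →
    ∃ l' : List St, l'.length = l.length + 2 ∧ visited step e l' = insert a (visited step e l) := by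
  induction l with
  | nil =>
    intro e hb
    simp only [visited, Finset.mem_singleton] at hb
    subst hb
    refine ⟨[s, s'], by simp, ?_⟩
    simp only [visited, h1, h2]
    ext y; simp
  | cons t l ih =>
    intro e hb
    by_cases hbe : b = e
    · subst hbe
      refine ⟨s :: s' :: t :: l, by simp, ?_⟩
      simp only [visited, h1, h2]
      ext y; simp
    · simp only [visited, Finset.mem_insert, hbe, false_or] at hb
      obtain ⟨l', hl, hv⟩ := ih _ hb
      refine ⟨t :: l', by simp [hl], ?_⟩
      simp only [visited, hv]
      ext y; simp; tauto

/-- Cut-connectedness of a finite set. -/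
def CutConn (adj : E → E → Prop) (A : Finset E) : Prop :=
  ∀ B ⊆ A, B.Nonempty → B ≠ A → ∃ b ∈ B, ∃ a ∈ A, a ∉ B ∧ adj b a

lemma exists_walk (step : E → St → E) (adj : E → E → Prop)
    (hadj : ∀ a b, adj a b → (∃ s, step a s = b) ∧ (∃ s, step b s = a))
    (A : Finset E) (hA : CutConn adj A) (e : E) (he : e ∈ A) :
    ∃ l : List St, l.length = 2 * (A.card - 1) ∧ visited step e l = A := by
  have key : ∀ n : ℕ, n < A.card → ∃ l : List St, l.length = 2 * n ∧
      visited step e l ⊆ A ∧ (visited step e l).card = n + 1 := by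
    intro n
    induction n with
    | zero => intro _; exact ⟨[], by simp [visited, he]⟩
    | succ n ih =>
      intro hn
      obtain ⟨l, h1, h2, h3⟩ := ih (by omega)
      obtain ⟨b, hb, a, ha, hab, hadj'⟩ := hA _ h2 ⟨e, mem_visited_start _ _ _⟩
        (by intro h; rw [h] at h3; omega)
      obtain ⟨⟨s, hs⟩, ⟨s', hs'⟩⟩ := hadj _ _ hadj'
      obtain ⟨l', hl', hv⟩ := visited_splice step b a s s' hs hs' l e hb
      refine ⟨l', by omega, ?_, ?_⟩
      · rw [hv]; exact Finset.insert_subset ha h2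
      · rw [hv, Finset.card_insert_of_notMem hab, h3]
  have hpos : 0 < A.card := Finset.card_pos.mpr ⟨e, he⟩
  obtain ⟨l, h1, h2, h3⟩ := key (A.card - 1) (by omega)
  exact ⟨l, h1, Finset.eq_of_subset_of_card_le h2 (by omega)⟩

lemma card_family_le [Fintype St] (step : E → St → E) (adj : E → E → Prop)
    (hadj : ∀ a b, adj a b → (∃ s, step a s = b) ∧ (∃ s, step b s = a))
    (root : ℕ → E) (n : ℕ) (F : Finset (Finset E))
    (hF : ∀ A ∈ F, A.card = n ∧ CutConn adj A ∧ ∃ k < n, root k ∈ A) :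
    F.card ≤ n * (Fintype.card St) ^ (2 * (n - 1)) := by
  classical
  let G : Finset (Finset E) := ((Finset.range n) ×ˢ
    (Finset.univ : Finset (List.Vector St (2 * (n - 1))))).image
      (fun p => visited step (root p.1) p.2.1)
  have hsub : F ⊆ G := by
    intro A hA
    obtain ⟨h1, h2, k, hk, hr⟩ := hF A hA
    obtain ⟨l, hl, hv⟩ := exists_walk step adj hadj A h2 (root k) hr
    simp only [G, Finset.mem_image, Finset.mem_product, Finset.mem_range, Finset.mem_univ,
      and_true, Prod.exists]
    exact ⟨k, ⟨l, by rw [hl, h1]⟩, hk, hv⟩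
  calc F.card ≤ G.card := Finset.card_le_card hsub
    _ ≤ _ := Finset.card_image_le
    _ = _ := by
      rw [Finset.card_product, Finset.card_range, Finset.card_univ, card_vector]

end Walks

/-! ### Part 2: lattice geometry, closed sets of edges -/

/-- Edges `(x,i)` stands for the edge between `x` and `x + e_i`. -/
abbrev Edge (d : ℕ) := V d × Fin d

/-- Unit vector. -/
def uv (i : Fin d) : V d := Pi.single i 1

lemma uv_same (i : Fin d) : uv i i = 1 := by simp [uv]
lemma uv_ne {i j : Fin d} (h : j ≠ i) : uv i j = 0 := by simp [uv, h]
lemma uv_cases (i j : Fin d) : uv i j = 0 ∨ uv i j = 1 := by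
  by_cases h : j = i
  · subst h; right; exact uv_same _
  · left; exact uv_ne h

/-- Two edges are adjacent when their base points are at sup-distance at most one. -/
def eadj (e f : Edge d) : Prop := ∀ c, |e.1 c - f.1 c| ≤ 1

/-- Steps in the edge graph. -/
def estep (e : Edge d) (s : (Fin d → Fin 3) × Fin d) : Edge d :=
  (fun c => e.1 c + ((s.1 c : ℕ) : ℤ) - 1, s.2)

lemma eadj_step (a b : Edge d) (h : eadj a b) : ∃ s, estep a s = b := by
  refine ⟨(fun c => ⟨(b.1 c - a.1 c + 1).toNat, ?_⟩, b.2), ?_⟩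
  · have := abs_le.mp (h c); omega
  · refine Prod.ext ?_ rfl
    funext c
    have := abs_le.mp (h c)
    simp only [estep]; omega

lemma eadj_symm {a b : Edge d} (h : eadj a b) : eadj b a := by
  intro c; rw [abs_sub_comm]; exact h c

/-- Indicator with values in `ZMod 2`. -/
def ind (A : Finset (Edge d)) (e : Edge d) : ZMod 2 := if e ∈ A then 1 else 0

lemma ind_eq_zero {A : Finset (Edge d)} {e : Edge d} (h : e ∉ A) : ind A e = 0 := by simp [ind, h]
lemma ind_eq_one {A : Finset (Edge d)} {e : Edge d} (h : e ∈ A) : ind A e = 1 := by simp [ind, h]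
lemma mem_of_ind_ne {A : Finset (Edge d)} {e : Edge d} (h : ind A e ≠ 0) : e ∈ A := by
  by_contra h'; exact h (ind_eq_zero h')

/-- The mod-2 closedness on plaquettes. -/
def EClosed (A : Finset (Edge d)) : Prop := ∀ (x : V d) (i j : Fin d),
  ind A (x, i) + ind A (x + uv i, j) = ind A (x, j) + ind A (x + uv j, i)

/-- Number mod 2 of edges of `A` on the ray starting from `x` in direction `i0`. -/
def gf (i0 : Fin d) (K : ℤ) (A : Finset (Edge d)) (x : V d) : ZMod 2 :=
  ∑ k ∈ Finset.range (K - x i0).toNat, ind A (x + Pi.single i0 (k : ℤ), i0)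

lemma gf_dir0 (i0 : Fin d) (K : ℤ) (A : Finset (Edge d)) (hK : ∀ e ∈ A, e.1 i0 < K) (x : V d) :
    gf i0 K A x = ind A (x, i0) + gf i0 K A (x + uv i0) := by
  unfold gf
  by_cases hx : x i0 < K
  · have h1 : (K - x i0).toNat = (K - (x + uv i0) i0).toNat + 1 := by
      simp only [Pi.add_apply, uv_same]; omega
    rw [h1, Finset.sum_range_succ', add_comm]
    congr 1
    · simp
    · refine Finset.sum_congr rfl fun k _ => ?_
      congr 2
      rw [add_assoc]
      congr 1
      funext c
      by_cases hc : c = i0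
      · subst hc; simp [uv]; ring
      · simp [uv, hc]
  · have h1 : (K - x i0).toNat = 0 := by omega
    have h2 : (K - (x + uv i0) i0).toNat = 0 := by
      simp only [Pi.add_apply, uv_same]; omega
    rw [h1, h2, ind_eq_zero]
    · simp
    · intro h; exact hx (hK _ h)

lemma gf_dir (i0 : Fin d) (K : ℤ) (A : Finset (Edge d)) (hK : ∀ e ∈ A, e.1 i0 < K)
    (hA : EClosed A) (x : V d) (i : Fin d) :
    gf i0 K A x = ind A (x, i) + gf i0 K A (x + uv i) := by
  by_cases hi : i = i0
  · subst hi; exact gf_dir0 i K A hK x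
  have hi' : i0 ≠ i := fun h => hi h.symm
  unfold gf
  have hM : (K - (x + uv i) i0).toNat = (K - x i0).toNat := by
    simp [uv_ne hi']
  rw [hM]
  set M := (K - x i0).toNat with hMdef
  have key : ∀ m : ℕ, ∑ k ∈ Finset.range m, ind A (x + Pi.single i0 (k : ℤ), i0) =
      ind A (x, i) + ind A (x + Pi.single i0 (m : ℤ), i) +
      ∑ k ∈ Finset.range m, ind A (x + uv i + Pi.single i0 (k : ℤ), i0) := by
    intro m
    induction m with
    | zero => simp [CharTwo.add_self_eq_zero]
    | succ m ih =>
      rw [Finset.sum_range_succ, Finset.sum_range_succ, ih]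
      have hc := hA (x + Pi.single i0 (m : ℤ)) i0 i
      have e1 : x + Pi.single i0 (m : ℤ) + uv i0 = x + Pi.single i0 ((m + 1 : ℕ) : ℤ) := by
        rw [add_assoc]; congr 1
        funext c
        by_cases hc : c = i0
        · subst hc; simp [uv]
        · simp [uv, hc]
      have e2 : x + Pi.single i0 (m : ℤ) + uv i = x + uv i + Pi.single i0 (m : ℤ) := by
        abel
      rw [e1, e2] at hc
      generalize ind A (x + Pi.single i0 (m : ℤ), i0) = a at *
      generalize ind A (x + Pi.single i0 ((m + 1 : ℕ) : ℤ), i) = b at *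
      generalize ind A (x + Pi.single i0 (m : ℤ), i) = c at *
      generalize ind A (x + uv i + Pi.single i0 (m : ℤ), i0) = e at *
      have hb : b = a + (c + e) := by
        rw [← hc, ← add_assoc, CharTwo.add_self_eq_zero, zero_add]
      rw [hb]
      have hcc : c + c = 0 := CharTwo.add_self_eq_zero c
      have hee : e + e = 0 := CharTwo.add_self_eq_zero e
      linear_combination -hee
  have hz : ind A (x + Pi.single i0 (M : ℤ), i) = 0 := by
    refine ind_eq_zero fun h => ?_
    have := hK _ h
    simp at this
    omega
  rw [key M, hz, add_zero]

lemma gf_add (i0 : Fin d) (K : ℤ) (A B : Finset (Edge d)) (hBA : B ⊆ A) (x : V d) :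
    gf i0 K A x = gf i0 K B x + gf i0 K (A \ B) x := by
  unfold gf
  rw [← Finset.sum_add_distrib]
  refine Finset.sum_congr rfl fun k _ => ?_
  unfold ind
  by_cases h1 : (x + Pi.single i0 (k : ℤ), i0) ∈ B
  · simp [h1, hBA h1]
  · by_cases h2 : (x + Pi.single i0 (k : ℤ), i0) ∈ A <;> simp [h1, h2]

/-- Box membership. -/
def inBox (N : ℤ) (x : V d) : Prop := ∀ c, |x c| ≤ N

/-- All edges of `A` touch the box. -/
def Touch (N : ℤ) (A : Finset (Edge d)) : Prop := ∀ e ∈ A, inBox N e.1 ∨ inBox N (e.1 + uv e.2)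

lemma Touch.lt {N : ℤ} {A : Finset (Edge d)} (h : Touch N A) (i0 : Fin d) :
    ∀ e ∈ A, e.1 i0 < N + 1 := by
  intro e he
  rcases h e he with h | h
  · have := abs_le.mp (h i0); omega
  · have := abs_le.mp (h i0)
    simp only [Pi.add_apply] at this
    rcases uv_cases e.2 i0 with h' | h' <;> omega

lemma notMem_of_coord {N : ℤ} {A : Finset (Edge d)} (h : Touch N A) (y : V d) (i j : Fin d)
    (hji : j ≠ i) (hy : N < |y j|) : (y, i) ∉ A := by
  intro hm
  rcases h _ hm with h | h
  · have := h j; simp only at this; omega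
  · have := h j
    simp only [Pi.add_apply, uv_ne hji, add_zero] at this
    omega

lemma gf_zero_of_coord (i0 j : Fin d) (hj : j ≠ i0) {N : ℤ} {A : Finset (Edge d)}
    (h : Touch N A) (x : V d) (hx : N < |x j|) : gf i0 (N + 1) A x = 0 := by
  unfold gf
  refine Finset.sum_eq_zero fun k _ => ?_
  refine ind_eq_zero (notMem_of_coord h _ _ j hj ?_)
  simpa [hj] using hx

lemma gf_outside (i0 i1 : Fin d) (h01 : i1 ≠ i0) {N : ℤ} {A : Finset (Edge d)}
    (h : Touch N A) (hA : EClosed A) (x : V d) (hx : ¬ inBox N x) : gf i0 (N + 1) A x = 0 := by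
  unfold inBox at hx
  push Not at hx
  obtain ⟨c, hc⟩ := hx
  by_cases hc0 : c = i0
  · subst hc0
    rcases lt_abs.mp hc with hc | hc
    · unfold gf
      have : (N + 1 - x c).toNat = 0 := by omega
      simp [this]
    · -- walk in direction i1
      have key : ∀ m : ℕ, gf c (N + 1) A x = gf c (N + 1) A (x + Pi.single i1 (m : ℤ)) := by
        intro m
        induction m with
        | zero => simp
        | succ m ih =>
          rw [ih, gf_dir c (N + 1) A (h.lt c) hA _ i1, ind_eq_zero, zero_add]
          · congr 1
            rw [add_assoc]; congr 1
            funext b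
            by_cases hb : b = i1
            · subst hb; simp [uv]
            · simp [uv, hb]
          · refine notMem_of_coord h _ _ c (Ne.symm h01) ?_
            have : c ≠ i1 := Ne.symm h01
            simp [this]
            exact lt_abs.mpr (Or.inr hc)
      rw [key (N + 1 + |x i1|).toNat]
      refine gf_zero_of_coord c i1 h01 h _ ?_
      have h1 := neg_abs_le (x i1)
      have h3 := abs_nonneg (x i1)
      simp only [Pi.add_apply, Pi.single_eq_same]
      refine lt_abs.mpr (Or.inl ?_)
      omega
  · exact gf_zero_of_coord i0 c hc0 h x hc

lemma zmod2_cases (a : ZMod 2) : a = 0 ∨ a = 1 := by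
  revert a; decide

/-- Finding an edge of `A` on the line through `v`, close to `v`. -/
lemma exists_root (i0 i1 : Fin d) (h01 : i1 ≠ i0) {N : ℤ} {A : Finset (Edge d)}
    (h : Touch N A) (hA : EClosed A) (v : V d) (hv : gf i0 (N + 1) A v = 1) :
    ∃ k < A.card, (v + Pi.single i0 (k : ℤ), i0) ∈ A := by
  classical
  -- along any direction from a point with gf = 1 there is an exit
  have exit : ∀ (i : Fin d) (y : V d), gf i0 (N + 1) A y = 1 →
      ∃ k : ℕ, gf i0 (N + 1) A (y + Pi.single i (k : ℤ)) ≠ 1 := by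
    intro i y _
    refine ⟨(N + 1 + |y i|).toNat, ?_⟩
    rw [gf_outside i0 i1 h01 h hA]
    · simp
    · intro hb
      have := abs_le.mp (hb i)
      simp only [Pi.add_apply, Pi.single_eq_same] at this
      have h1 := neg_abs_le (y i)
      omega
  have edge : ∀ (i : Fin d) (y : V d), gf i0 (N + 1) A y = 1 →
      ∃ k : ℕ, (y + Pi.single i (k : ℤ), i) ∈ A ∧
        ∀ l ≤ k, gf i0 (N + 1) A (y + Pi.single i (l : ℤ)) = 1 := by
    intro i y hy
    have hex := exit i y hy
    set m := Nat.find hex with hm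
    have hm1 := Nat.find_spec hex
    rw [← hm] at hm1
    have hm0 : m ≠ 0 := by
      intro h0; rw [h0] at hm1; simp [hy] at hm1
    obtain ⟨k, hk⟩ := Nat.exists_eq_succ_of_ne_zero hm0
    have hle : ∀ l ≤ k, gf i0 (N + 1) A (y + Pi.single i (l : ℤ)) = 1 := by
      intro l hl
      have := Nat.find_min hex (m := l) (by omega)
      simpa using this
    refine ⟨k, ?_, hle⟩
    have hd := gf_dir i0 (N + 1) A (h.lt i0) hA (y + Pi.single i (k : ℤ)) i
    have e1 : y + Pi.single i (k : ℤ) + uv i = y + Pi.single i (m : ℤ) := by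
      rw [add_assoc]; congr 1
      funext b
      by_cases hb : b = i
      · subst hb; simp [uv, hk]
      · simp [uv, hb]
    rw [e1, hle k le_rfl] at hd
    refine mem_of_ind_ne ?_
    intro h0
    rw [h0, zero_add] at hd
    exact hm1 hd.symm
  obtain ⟨k, hk, hle⟩ := edge i0 v hv
  refine ⟨k, ?_, hk⟩
  have hall : ∀ l : Fin (k + 1), ∃ m : ℕ,
      (v + Pi.single i0 ((l : ℕ) : ℤ) + Pi.single i1 (m : ℤ), i1) ∈ A := by
    intro l
    obtain ⟨m, hm, _⟩ := edge i1 _ (hle l (by omega))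
    exact ⟨m, hm⟩
  choose m hm using hall
  have hinj : Function.Injective (fun l : Fin (k + 1) =>
      ((v + Pi.single i0 ((l : ℕ) : ℤ) + Pi.single i1 (m l : ℤ), i1) : Edge d)) := by
    intro a b hab
    have := congrFun (congrArg Prod.fst hab) i0
    simp only [Pi.add_apply, Pi.single_eq_same, Pi.single_eq_of_ne (Ne.symm h01)] at this
    ext; omega
  have : (Finset.univ.image (fun l : Fin (k + 1) =>
      ((v + Pi.single i0 ((l : ℕ) : ℤ) + Pi.single i1 (m l : ℤ), i1) : Edge d))).card ≤ A.card := by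
    apply Finset.card_le_card
    intro e he
    simp only [Finset.mem_image, Finset.mem_univ, true_and] at he
    obtain ⟨l, rfl⟩ := he
    exact hm l
  rw [Finset.card_image_of_injective _ hinj] at this
  simp at this
  omega

lemma closed_of_cut {A B : Finset (Edge d)} (hA : EClosed A) (hBA : B ⊆ A)
    (hcut : ∀ b ∈ B, ∀ a ∈ A, eadj b a → a ∈ B) : EClosed B := by
  intro x i j
  -- the four edges
  have hadj : ∀ e f : Edge d, e ∈ ({(x, i), (x + uv i, j), (x, j), (x + uv j, i)} : Set (Edge d)) →
      f ∈ ({(x, i), (x + uv i, j), (x, j), (x + uv j, i)} : Set (Edge d)) → eadj e f := by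
    intro e f he hf c
    have h1 := uv_cases i c
    have h2 := uv_cases j c
    simp only [Set.mem_insert_iff, Set.mem_singleton_iff] at he hf
    rcases he with rfl | rfl | rfl | rfl <;> rcases hf with rfl | rfl | rfl | rfl <;>
      simp only [Pi.add_apply] <;> rw [abs_le] <;> omega
  by_cases hex : ∃ e ∈ ({(x, i), (x + uv i, j), (x, j), (x + uv j, i)} : Set (Edge d)), e ∈ B
  · obtain ⟨e, he, heB⟩ := hex
    have hiff : ∀ f ∈ ({(x, i), (x + uv i, j), (x, j), (x + uv j, i)} : Set (Edge d)),
        ind B f = ind A f := by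
      intro f hf
      by_cases hfA : f ∈ A
      · rw [ind_eq_one hfA, ind_eq_one (hcut e heB f hfA (hadj e f he hf))]
      · rw [ind_eq_zero hfA, ind_eq_zero (fun h => hfA (hBA h))]
    rw [hiff (x, i) (by simp), hiff (x + uv i, j) (by simp), hiff (x, j) (by simp),
      hiff (x + uv j, i) (by simp)]
    exact hA x i j
  · push Not at hex
    rw [ind_eq_zero (hex (x, i) (by simp)), ind_eq_zero (hex (x + uv i, j) (by simp)),
      ind_eq_zero (hex (x, j) (by simp)), ind_eq_zero (hex (x + uv j, i) (by simp))]

lemma closed_sdiff {A B : Finset (Edge d)} (hA : EClosed A) (hBA : B ⊆ A)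
    (hcut : ∀ b ∈ B, ∀ a ∈ A, eadj b a → a ∈ B) : EClosed (A \ B) := by
  refine closed_of_cut hA Finset.sdiff_subset ?_
  intro b hb a ha hab
  rw [Finset.mem_sdiff] at hb ⊢
  refine ⟨ha, fun haB => hb.2 (hcut a haB b hb.1 (eadj_symm hab))⟩

/-- Existence of a connected closed subset enclosing `v`. -/
lemma exists_contour (i0 : Fin d) (K : ℤ) (D : Finset (Edge d)) (hD : EClosed D) (v : V d)
    (hv : gf i0 K D v = 1) :
    ∃ A ⊆ D, EClosed A ∧ CutConn eadj A ∧ gf i0 K A v = 1 := by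
  classical
  let F := D.powerset.filter (fun A => EClosed A ∧ gf i0 K A v = 1)
  have hF : F.Nonempty := ⟨D, by simp [F, hD, hv]⟩
  obtain ⟨A, hAF, hmin⟩ := Finset.exists_min_image F Finset.card hF
  simp only [F, Finset.mem_filter, Finset.mem_powerset] at hAF hmin
  obtain ⟨hAD, hA, hAv⟩ := hAF
  refine ⟨A, hAD, hA, ?_, hAv⟩
  intro B hBA hBne hBneA
  by_contra hcon
  push Not at hcon
  have hcut : ∀ b ∈ B, ∀ a ∈ A, eadj b a → a ∈ B := by
    intro b hb a ha hab
    by_contra haB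
    exact hcon b hb a ha haB hab
  have hadd := gf_add i0 K A B hBA v
  have hlt : B.card < A.card := Finset.card_lt_card (hBA.ssubset_of_ne hBneA)
  have hlt2 : (A \ B).card < A.card := by
    rw [Finset.card_sdiff_of_subset hBA]
    have := hBne.card_pos
    omega
  rcases zmod2_cases (gf i0 K B v) with h0 | h1
  · rw [hAv, h0, zero_add] at hadd
    have := hmin (A \ B) ⟨Finset.sdiff_subset.trans hAD, closed_sdiff hA hBA hcut, hadd.symm⟩
    omega
  · have := hmin B ⟨hBA.trans hAD, closed_of_cut hA hBA hcut, h1⟩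
    omega

/-- Any lattice function taking distinct values at `p`, `q` jumps along an edge based in the
rectangle spanned by `p` and `q`. -/
lemma exists_jump (g : V d → ZMod 2) (q : V d) : ∀ (n : ℕ) (p : V d), dist1 p q = n → g p ≠ g q →
    ∃ (x : V d) (i : Fin d), g x ≠ g (x + uv i) ∧
      ∀ c, min (p c) (q c) ≤ x c ∧ x c ≤ max (p c) (q c) := by
  intro n
  induction n with
  | zero =>
    intro p hp hne
    exfalso; apply hne; congr 1
    funext c
    unfold dist1 at hp
    have := (Finset.sum_eq_zero_iff.mp hp) c (Finset.mem_univ c)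
    omega
  | succ n ih =>
    intro p hp hne
    have hpq : ∃ c, p c ≠ q c := by
      by_contra hcon
      push Not at hcon
      exact hne (congrArg g (funext hcon))
    obtain ⟨c, hc⟩ := hpq
    have hdist : ∀ p' : V d, (∀ b, b ≠ c → p' b = p b) →
        (p' c - q c).natAbs + 1 = (p c - q c).natAbs → dist1 p' q = n := by
      intro p' h1 h2
      unfold dist1 at hp ⊢
      rw [← Finset.add_sum_erase _ _ (Finset.mem_univ c)] at hp ⊢
      have : ∑ x ∈ Finset.univ.erase c, (p' x - q x).natAbs =
          ∑ x ∈ Finset.univ.erase c, (p x - q x).natAbs :=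
        Finset.sum_congr rfl fun b hb => by rw [h1 b (Finset.ne_of_mem_erase hb)]
      omega
    rcases lt_or_gt_of_ne hc with hlt | hgt
    · -- move up
      by_cases hj : g p = g (p + uv c)
      · obtain ⟨x, i, h1, h2⟩ := ih (p + uv c) (hdist _ (fun b hb => by simp [uv_ne hb])
          (by simp only [Pi.add_apply, uv_same]; omega)) (by rwa [← hj])
        refine ⟨x, i, h1, fun b => ?_⟩
        have := h2 b
        by_cases hb : b = c
        · subst hb
          simp only [Pi.add_apply, uv_same] at this
          omega
        · simpa [uv_ne hb] using this
      · exact ⟨p, c, hj, fun b => by omega⟩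
    · by_cases hj : g p = g (p - uv c)
      · obtain ⟨x, i, h1, h2⟩ := ih (p - uv c) (hdist _ (fun b hb => by simp [uv_ne hb])
          (by simp only [Pi.sub_apply, uv_same]; omega)) (by rwa [← hj])
        refine ⟨x, i, h1, fun b => ?_⟩
        have := h2 b
        by_cases hb : b = c
        · subst hb
          simp only [Pi.sub_apply, uv_same] at this
          omega
        · simpa [uv_ne hb] using this
      · refine ⟨p - uv c, c, ?_, fun b => ?_⟩
        · rw [sub_add_cancel]; exact fun h => hj h.symm
        · by_cases hb : b = c
          · subst hb
            simp only [Pi.sub_apply, uv_same]; omega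
          · simp [uv_ne hb]

/-! ### Part 3: summability -/

lemma fill_restrict (Λ : Finset (V d)) (ω : Config d) : fill Λ (fun x => ω x.1) ω = ω := by
  funext x; simp [fill]

lemma bddAbove_abs {Φ : Interaction d} (hL : IsLocal Φ) (Λ : Finset (V d)) :
    BddAbove (Set.range fun ω : Config d => |Φ Λ ω|) := by
  refine Set.Finite.bddAbove ?_
  refine (Set.finite_range (fun f : ↥Λ → Bool => |Φ Λ (fill Λ f plusC)|)).subset ?_
  rintro _ ⟨ω, rfl⟩
  refine ⟨fun x => ω x.1, ?_⟩
  simp only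
  congr 1
  refine hL Λ _ _ fun x hx => ?_
  simp [fill, hx]

lemma abs_le_supNorm {Φ : Interaction d} (hL : IsLocal Φ) (Λ : Finset (V d)) (ω : Config d) :
    |Φ Λ ω| ≤ supNorm Φ Λ := le_ciSup (bddAbove_abs hL Λ) ω

lemma supNorm_nonneg (Φ : Interaction d) (Λ : Finset (V d)) : 0 ≤ supNorm Φ Λ :=
  Real.iSup_nonneg fun _ => abs_nonneg _

/-- Translation of finite sets as an equivalence. -/
def shiftE (a : V d) : Finset (V d) ≃ Finset (V d) where
  toFun X := X.image (fun x => x - a)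
  invFun X := X.image (fun x => x + a)
  left_inv X := by
    beta_reduce
    rw [Finset.image_image]
    simp only [Function.comp_def, sub_add_cancel, Finset.image_id']
  right_inv X := by
    beta_reduce
    rw [Finset.image_image]
    simp only [Function.comp_def, add_sub_cancel_right, Finset.image_id']

lemma mem_shiftE (a x : V d) (X : Finset (V d)) : x ∈ shiftE a X ↔ x + a ∈ X := by
  simp only [shiftE, Equiv.coe_fn_mk, Finset.mem_image]
  constructor
  · rintro ⟨y, hy, rfl⟩; simpa using hy
  · intro h; exact ⟨_, h, by simp⟩

lemma translate_surj (a : V d) : Function.Surjective (translate a : Config d → Config d) := by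
  intro ω
  exact ⟨translate (-a) ω, by funext x; simp [translate]⟩

lemma supNorm_shift {Φ : Interaction d} (hT : TransInv Φ) (a : V d) (X : Finset (V d)) :
    supNorm Φ (shiftE a X) = supNorm Φ X := by
  unfold supNorm
  rw [← (translate_surj a).iSup_comp]
  refine iSup_congr fun ω => ?_
  congr 1
  exact hT a X ω

lemma distInf_shift (a x y : V d) : distInf (x - a) (y - a) = distInf x y := by
  simp [distInf]

lemma diam_shift (a : V d) (X : Finset (V d)) : diam (shiftE a X) = diam X := by
  unfold diam shiftE
  simp only [Equiv.coe_fn_mk, Finset.sup_image, Function.comp_def, distInf_shift]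

lemma summable_mem {Φ : Interaction d} (hT : TransInv Φ) (hS : AbsSummable Φ) (x : V d) :
    Summable fun X : Finset (V d) => if x ∈ X then supNorm Φ X else 0 := by
  have := (shiftE x).summable_iff.mpr hS
  refine this.congr fun X => ?_
  simp [normTerm, mem_shiftE, supNorm_shift hT]

lemma summable_meet {Φ : Interaction d} (hT : TransInv Φ) (hS : AbsSummable Φ)
    (Λ : Finset (V d)) :
    Summable fun X : Finset (V d) => if (X ∩ Λ).Nonempty then supNorm Φ X else 0 := by
  have h1 : Summable fun X : Finset (V d) => ∑ x ∈ Λ, if x ∈ X then supNorm Φ X else 0 :=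
    summable_sum fun x _ => summable_mem hT hS x
  refine Summable.of_nonneg_of_le (fun X => ?_) (fun X => ?_) h1
  · split_ifs
    · exact supNorm_nonneg _ _
    · exact le_rfl
  · have hnn : ∀ x ∈ Λ, 0 ≤ if x ∈ X then supNorm Φ X else 0 := fun x _ => by
      split_ifs
      · exact supNorm_nonneg _ _
      · exact le_rfl
    split_ifs with h
    · obtain ⟨x, hx⟩ := h
      rw [Finset.mem_inter] at hx
      have := Finset.single_le_sum hnn hx.2
      simpa [hx.1] using this
    · exact Finset.sum_nonneg hnn

lemma summable_ham {Φ : Interaction d} (hL : IsLocal Φ) (hT : TransInv Φ) (hS : AbsSummable Φ)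
    (Λ : Finset (V d)) (ω : Config d) :
    Summable fun X : Finset (V d) => if (X ∩ Λ).Nonempty then Φ X ω else 0 := by
  refine Summable.of_norm_bounded (summable_meet hT hS Λ) fun X => ?_
  split_ifs
  · exact abs_le_supNorm hL X ω
  · simp

lemma continuous_local {Φ : Interaction d} (hL : IsLocal Φ) (X : Finset (V d)) :
    Continuous (Φ X) := by
  have h : Φ X = (fun f : ↥X → Bool => Φ X (fill X f plusC)) ∘ (fun ω x => ω x.1) := by
    funext ω
    refine hL X _ _ fun x hx => ?_
    simp [fill, hx]
  rw [h]
  exact continuous_of_discreteTopology.comp (by fun_prop)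

lemma continuous_ham {Φ : Interaction d} (hL : IsLocal Φ) (hT : TransInv Φ) (hS : AbsSummable Φ)
    (Λ : Finset (V d)) : Continuous (ham Φ Λ) := by
  unfold ham
  refine continuous_tsum (fun X => ?_) (summable_meet hT hS Λ) fun X ω => ?_
  · split_ifs
    · exact continuous_local hL X
    · exact continuous_const
  · split_ifs
    · exact abs_le_supNorm hL X ω
    · simp

lemma continuous_fill (Λ : Finset (V d)) (f : ↥Λ → Bool) : Continuous (fill Λ f) := by
  refine continuous_pi fun x => ?_
  unfold fill
  by_cases h : x ∈ Λ
  · simp only [h, dite_true]; exact continuous_const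
  · simp only [h, dite_false]; exact continuous_apply x

lemma gibbsZ_pos (Φ : Interaction d) (Λ : Finset (V d)) (η : Config d) : 0 < gibbsZ Φ Λ η :=
  Finset.sum_pos (fun _ _ => Real.exp_pos _) Finset.univ_nonempty

lemma continuous_finGibbs {Φ : Interaction d} (hL : IsLocal Φ) (hT : TransInv Φ)
    (hS : AbsSummable Φ) (Λ : Finset (V d)) (f : ↥Λ → Bool) :
    Continuous fun η => finGibbs Φ Λ η f := by
  have h : ∀ f : ↥Λ → Bool, Continuous fun η => Real.exp (-(ham Φ Λ (fill Λ f η))) := fun f =>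
    Real.continuous_exp.comp ((continuous_ham hL hT hS Λ).comp (continuous_fill Λ f)).neg
  unfold finGibbs
  refine (h f).div (continuous_finsetSum _ fun f _ => h f) fun η => (gibbsZ_pos Φ Λ η).ne'

/-! The crossing estimate -/

lemma distInf_le_iff (x y : V d) (n : ℕ) : distInf x y ≤ n ↔ ∀ i, (x i - y i).natAbs ≤ n := by
  simp [distInf]

lemma tsum_ball (x : V d) (n : ℕ) (c : ENNReal) :
    ∑' p : V d, (if distInf x p ≤ n then c else 0) = ((2 * n + 1) ^ d : ℕ) * c := by
  rw [tsum_eq_sum (s := Finset.Icc (fun i => x i - n) (fun i => x i + n))]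
  · rw [Finset.sum_congr rfl (g := fun _ => c)]
    · rw [Finset.sum_const, nsmul_eq_mul, Pi.card_Icc]
      congr 2
      rw [Finset.prod_congr rfl (g := fun _ => 2 * n + 1)]
      · simp
      · intro i _
        rw [Int.card_Icc]; omega
    · intro p hp
      rw [Finset.mem_Icc] at hp
      rw [if_pos]
      rw [distInf_le_iff]
      intro i
      have h1 := hp.1 i
      have h2 := hp.2 i
      simp only at h1 h2
      omega
  · intro p hp
    rw [if_neg]
    intro h
    rw [distInf_le_iff] at h
    apply hp
    rw [Finset.mem_Icc]
    constructor <;> intro i <;> have := h i <;> simp only <;> omega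

lemma tsum_near {Ψ : Interaction d} (hT : TransInv Ψ) (hS : DSummable Ψ) (x : V d) :
    ∑' X : Finset (V d), ∑' p : V d,
      (if p ∈ X ∧ distInf x p ≤ diam X then ENNReal.ofReal (supNorm Ψ X) else 0)
      ≤ ENNReal.ofReal (2 ^ d * dnorm Ψ) := by
  rw [ENNReal.tsum_comm]
  have h1 : ∀ p : V d, ∑' X : Finset (V d),
      (if p ∈ X ∧ distInf x p ≤ diam X then ENNReal.ofReal (supNorm Ψ X) else 0) =
      ∑' Y : Finset (V d),
      (if 0 ∈ Y ∧ distInf x p ≤ diam Y then ENNReal.ofReal (supNorm Ψ Y) else 0) := by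
    intro p
    rw [← (shiftE p).tsum_eq (fun Y => if (0 : V d) ∈ Y ∧ distInf x p ≤ diam Y then
      ENNReal.ofReal (supNorm Ψ Y) else 0)]
    refine tsum_congr fun X => ?_
    simp only [mem_shiftE, zero_add, diam_shift, supNorm_shift hT]
  simp_rw [h1]
  rw [ENNReal.tsum_comm]
  have hnn : ∀ X, 0 ≤ dTerm Ψ X := fun X => by
    unfold dTerm; split_ifs
    · exact mul_nonneg (by positivity) (supNorm_nonneg _ _)
    · exact le_rfl
  unfold dnorm
  rw [← tsum_mul_left, ENNReal.ofReal_tsum_of_nonneg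
    (fun X => mul_nonneg (by positivity) (hnn X)) (hS.mul_left _)]
  refine ENNReal.tsum_le_tsum fun Y => ?_
  by_cases h0 : (0 : V d) ∈ Y
  · simp only [h0, true_and, tsum_ball, dTerm, if_true]
    rw [← ENNReal.ofReal_natCast, ← ENNReal.ofReal_mul (by positivity)]
    apply ENNReal.ofReal_le_ofReal
    rw [← mul_assoc, ← mul_pow]
    refine mul_le_mul_of_nonneg_right ?_ (supNorm_nonneg _ _)
    push_cast
    gcongr
    linarith
  · simp [h0]

lemma cross_bound {Ψ : Interaction d} (hT : TransInv Ψ) (hS : DSummable Ψ)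
    (A : Finset (Edge d)) (w : Finset (V d) → ℝ) (hw0 : ∀ X, 0 ≤ w X)
    (hw : ∀ X, w X ≠ 0 → w X ≤ supNorm Ψ X ∧ ∃ e ∈ A, ∃ p ∈ X, distInf e.1 p ≤ diam X) :
    Summable w ∧ ∑' X, w X ≤ A.card * (2 ^ d * dnorm Ψ) := by
  have hdn : 0 ≤ dnorm Ψ := tsum_nonneg fun X => by
    unfold dTerm; split_ifs
    · exact mul_nonneg (by positivity) (supNorm_nonneg _ _)
    · exact le_rfl
  have h1 : ∑' X, ENNReal.ofReal (w X) ≤ ENNReal.ofReal (A.card * (2 ^ d * dnorm Ψ)) := by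
    calc ∑' X, ENNReal.ofReal (w X) ≤ ∑' X, ∑ e ∈ A, ∑' p : V d,
      (if p ∈ X ∧ distInf e.1 p ≤ diam X then ENNReal.ofReal (supNorm Ψ X) else 0) := by
          refine ENNReal.tsum_le_tsum fun X => ?_
          by_cases h : w X = 0
          · simp [h]
          · obtain ⟨hle, e, he, p, hp, hd⟩ := hw X h
            refine le_trans ?_ (Finset.single_le_sum (fun _ _ => zero_le) he)
            refine le_trans ?_ (ENNReal.le_tsum p)
            rw [if_pos ⟨hp, hd⟩]
            exact ENNReal.ofReal_le_ofReal hle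
      _ = ∑ e ∈ A, ∑' X, ∑' p : V d,
      (if p ∈ X ∧ distInf e.1 p ≤ diam X then ENNReal.ofReal (supNorm Ψ X) else 0) := by
          rw [Summable.tsum_finsetSum fun _ _ => ENNReal.summable]
      _ ≤ ∑ e ∈ A, ENNReal.ofReal (2 ^ d * dnorm Ψ) :=
          Finset.sum_le_sum fun e _ => tsum_near hT hS e.1
      _ = _ := by
          rw [Finset.sum_const, nsmul_eq_mul, ENNReal.ofReal_mul (p := (A.card : ℝ)) (by positivity),
            ENNReal.ofReal_natCast]
  have hne : ∑' X, ENNReal.ofReal (w X) ≠ ⊤ := ne_top_of_le_ne_top ENNReal.ofReal_ne_top h1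
  have hsum : Summable w := by
    have := ENNReal.summable_toReal hne
    simpa [ENNReal.toReal_ofReal (hw0 _)] using this
  refine ⟨hsum, ?_⟩
  rw [← ENNReal.ofReal_tsum_of_nonneg hw0 hsum] at h1
  exact (ENNReal.ofReal_le_ofReal_iff (by positivity)).mp h1

/-! ### Part 4: the Ising interaction and the energy estimate -/

/-- The edge condition appearing in the Ising interaction. -/
def edgeCond (X : Finset (V d)) : Prop :=
  X.card = 2 ∧ ∀ x ∈ X, ∀ y ∈ X, x ≠ y → dist1 x y = 1

open scoped Classical in
lemma ising_eq (β : ℝ) (X : Finset (V d)) (ω : Config d) :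
    ising β X ω = if edgeCond X then -β * ∏ x ∈ X, spin (ω x) else 0 := by
  unfold ising edgeCond
  congr

lemma ising_local (β : ℝ) : IsLocal (ising β : Interaction d) := by
  intro Λ ω ω' h
  unfold ising
  split_ifs
  · congr 1
    exact Finset.prod_congr rfl fun x hx => by rw [h x hx]
  · rfl

lemma dist1_shift (a x y : V d) : dist1 (x - a) (y - a) = dist1 x y := by
  simp [dist1]

lemma edgeCond_shift (a : V d) (X : Finset (V d)) :
    edgeCond (X.image fun x => x - a) ↔ edgeCond X := by
  unfold edgeCond
  rw [Finset.card_image_of_injective _ (sub_left_injective)]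
  simp only [Finset.mem_image, forall_exists_index, and_imp, forall_apply_eq_imp_iff₂,
    dist1_shift, ne_eq, sub_left_inj]

lemma ising_transInv (β : ℝ) : TransInv (ising β : Interaction d) := by
  classical
  intro a X ω
  rw [ising_eq, ising_eq]
  simp only [edgeCond_shift]
  rw [Finset.prod_image (fun x _ y _ h => sub_left_injective h)]
  simp [translate]

lemma dist1_eq_one {x y : V d} (h : dist1 x y = 1) : ∃ i, y = x + uv i ∨ x = y + uv i := by
  unfold dist1 at h
  have hne : ∃ i, x i ≠ y i := by
    by_contra hcon
    push Not at hcon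
    simp [hcon] at h
  obtain ⟨i, hi⟩ := hne
  rw [← Finset.add_sum_erase _ _ (Finset.mem_univ i)] at h
  have h0 : ∑ j ∈ Finset.univ.erase i, (x j - y j).natAbs = 0 := by omega
  have h1 : (x i - y i).natAbs = 1 := by omega
  have h2 : ∀ j, j ≠ i → x j = y j := by
    intro j hj
    have := Finset.sum_eq_zero_iff.mp h0 j (Finset.mem_erase.mpr ⟨hj, Finset.mem_univ j⟩)
    omega
  refine ⟨i, ?_⟩
  by_cases hs : x i < y i
  · left; funext j
    by_cases hj : j = i
    · subst hj; simp only [Pi.add_apply, uv_same]; omega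
    · simp [uv_ne hj, h2 j hj]
  · right; funext j
    by_cases hj : j = i
    · subst hj; simp only [Pi.add_apply, uv_same]; omega
    · simp [uv_ne hj, h2 j hj]

/-- The two-point set of an edge. -/
def emap (e : Edge d) : Finset (V d) := {e.1, e.1 + uv e.2}

lemma ne_add_uv (x : V d) (i : Fin d) : x ≠ x + uv i := by
  intro h
  have := congrFun h i
  simp [uv_same] at this

lemma dist1_uv (x : V d) (i : Fin d) : dist1 x (x + uv i) = 1 := by
  unfold dist1
  rw [Finset.sum_eq_single i]
  · simp [uv_same]
  · intro j _ hj; simp [uv_ne hj]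
  · simp

lemma dist1_comm (x y : V d) : dist1 x y = dist1 y x := by
  unfold dist1
  exact Finset.sum_congr rfl fun i _ => by omega

lemma edgeCond_emap (e : Edge d) : edgeCond (emap e) := by
  refine ⟨Finset.card_pair (ne_add_uv _ _), ?_⟩
  intro x hx y hy hxy
  simp only [emap, Finset.mem_insert, Finset.mem_singleton] at hx hy
  rcases hx with rfl | rfl <;> rcases hy with rfl | rfl
  · exact absurd rfl hxy
  · exact dist1_uv _ _
  · rw [dist1_comm]; exact dist1_uv _ _
  · exact absurd rfl hxy

lemma exists_emap {X : Finset (V d)} (h : edgeCond X) : ∃ e : Edge d, X = emap e := by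
  obtain ⟨hc, hd⟩ := h
  obtain ⟨x, y, hxy, rfl⟩ := Finset.card_eq_two.mp hc
  obtain ⟨i, h | h⟩ := dist1_eq_one (hd x (by simp) y (by simp) hxy)
  · exact ⟨(x, i), by simp [emap, h]⟩
  · exact ⟨(y, i), by simp [emap, h, Finset.pair_comm]⟩

lemma emap_injective : Function.Injective (emap : Edge d → Finset (V d)) := by
  rintro ⟨x, i⟩ ⟨y, j⟩ h
  simp only [emap] at h
  have hx : x ∈ ({y, y + uv j} : Finset (V d)) := by rw [← h]; simp
  have hx' : x + uv i ∈ ({y, y + uv j} : Finset (V d)) := by rw [← h]; simp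
  simp only [Finset.mem_insert, Finset.mem_singleton] at hx hx'
  have hxi : ∀ k, uv k = uv i → k = i := by
    intro k hk
    by_contra hne
    have := congrFun hk k
    rw [uv_same, uv_ne hne] at this
    omega
  rcases hx with rfl | rfl
  · rcases hx' with h' | h'
    · exact absurd h'.symm (ne_add_uv _ _)
    · rw [add_right_inj] at h'
      rw [hxi j h'.symm]
  · rcases hx' with h' | h'
    · exfalso
      have := congrFun h' i
      simp only [Pi.add_apply, uv_same] at this
      rcases uv_cases j i with h'' | h'' <;> omega
    · exact absurd h'.symm (ne_add_uv _ _)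

lemma edge_subset_box {X : Finset (V d)} (h : edgeCond X) (h0 : (0 : V d) ∈ X) :
    X ⊆ Finset.Icc (fun _ => -1) (fun _ => 1) := by
  intro y hy
  rw [Finset.mem_Icc]
  by_cases hy0 : y = 0
  · subst hy0; constructor <;> intro i <;> simp
  · have h1 := h.2 0 h0 y hy (Ne.symm hy0)
    obtain ⟨i, h' | h'⟩ := dist1_eq_one h1
    · constructor <;> intro j <;> have := congrFun h' j <;>
        simp only [Pi.add_apply, Pi.zero_apply] at this <;>
        rcases uv_cases i j with h'' | h'' <;> simp only <;> omega
    · constructor <;> intro j <;> have := congrFun h' j <;>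
        simp only [Pi.add_apply, Pi.zero_apply] at this <;>
        rcases uv_cases i j with h'' | h'' <;> simp only <;> omega

lemma ising_absSummable (β : ℝ) : AbsSummable (ising β : Interaction d) := by
  classical
  refine summable_of_ne_finset_zero
    (s := (Finset.Icc (fun _ => -1) (fun _ => 1) : Finset (V d)).powerset) ?_
  intro X hX
  rw [Finset.mem_powerset] at hX
  unfold normTerm
  split_ifs with h0
  · have : ¬ edgeCond X := fun h => hX (edge_subset_box h h0)
    unfold supNorm
    simp [ising_eq, this]
  · rfl

lemma spin_not (b : Bool) : spin (!b) = - spin b := by cases b <;> simp [spin]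

lemma spin_mul_of_ne {a b : Bool} (h : a ≠ b) : spin a * spin b = -1 := by
  cases a <;> cases b <;> simp_all [spin]

lemma ising_flip (β : ℝ) : SpinFlipSymm (ising β : Interaction d) := by
  classical
  intro X ω
  rw [ising_eq, ising_eq]
  split_ifs with h
  · congr 1
    simp only [spin_not]
    rw [Finset.prod_neg, h.1]; simp
  · rfl

lemma iadd_local {Φ Ψ : Interaction d} (h1 : IsLocal Φ) (h2 : IsLocal Ψ) : IsLocal (Iadd Φ Ψ) := by
  intro Λ ω ω' h
  unfold Iadd
  rw [h1 Λ ω ω' h, h2 Λ ω ω' h]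

lemma iadd_transInv {Φ Ψ : Interaction d} (h1 : TransInv Φ) (h2 : TransInv Ψ) :
    TransInv (Iadd Φ Ψ) := by
  intro a Λ ω
  unfold Iadd
  rw [h1 a Λ ω, h2 a Λ ω]

lemma iadd_flip {Φ Ψ : Interaction d} (h1 : SpinFlipSymm Φ) (h2 : SpinFlipSymm Ψ) :
    SpinFlipSymm (Iadd Φ Ψ) := by
  intro Λ ω
  unfold Iadd
  rw [h1 Λ ω, h2 Λ ω]

lemma normTerm_nonneg (Φ : Interaction d) (X : Finset (V d)) : 0 ≤ normTerm Φ X := by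
  unfold normTerm; split_ifs
  · exact supNorm_nonneg _ _
  · exact le_rfl

lemma iadd_absSummable {Φ Ψ : Interaction d} (hL1 : IsLocal Φ) (hL2 : IsLocal Ψ)
    (h1 : AbsSummable Φ) (h2 : AbsSummable Ψ) : AbsSummable (Iadd Φ Ψ) := by
  refine Summable.of_nonneg_of_le (normTerm_nonneg _) (fun X => ?_) (h1.add h2)
  unfold normTerm
  split_ifs
  · refine Real.iSup_le (fun ω => ?_) (add_nonneg (supNorm_nonneg _ _) (supNorm_nonneg _ _))
    exact (abs_add_le _ _).trans (add_le_add (abs_le_supNorm hL1 X ω) (abs_le_supNorm hL2 X ω))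
  · simp

lemma absSummable_of_dSummable {Ψ : Interaction d} (h : DSummable Ψ) : AbsSummable Ψ := by
  refine Summable.of_nonneg_of_le (normTerm_nonneg _) (fun X => ?_) h
  unfold normTerm dTerm
  split_ifs
  · refine le_mul_of_one_le_left (supNorm_nonneg _ _) ?_
    refine one_le_pow₀ ?_
    push_cast
    linarith [(Nat.cast_nonneg (diam X) : (0:ℝ) ≤ _)]
  · exact le_rfl

lemma distInf_le_diam {X : Finset (V d)} {p q : V d} (hp : p ∈ X) (hq : q ∈ X) :
    distInf p q ≤ diam X :=
  (Finset.le_sup (f := fun y => distInf p y) hq).trans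
    (Finset.le_sup (f := fun x => X.sup fun y => distInf x y) hp)

lemma ising_energy_term (β : ℝ) (Λ S : Finset (V d)) (hSΛ : S ⊆ Λ) (A : Finset (Edge d))
    (hA : ∀ x i, (x, i) ∈ A ↔ ¬ (x ∈ S ↔ x + uv i ∈ S)) (ω : Config d)
    (hD : ∀ x i, (x, i) ∈ A → ω x ≠ ω (x + uv i)) (X : Finset (V d)) :
    (if (X ∩ Λ).Nonempty then ising β X ω else 0) -
      (if (X ∩ Λ).Nonempty then ising β X (flipOn S ω) else 0) =
    if X ∈ A.image emap then 2 * β else 0 := by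
  classical
  by_cases hX : edgeCond X
  · obtain ⟨⟨x, i⟩, rfl⟩ := exists_emap hX
    have hmem : emap (x, i) ∈ A.image emap ↔ (x, i) ∈ A := by
      constructor
      · intro h
        obtain ⟨e, he, h'⟩ := Finset.mem_image.mp h
        rwa [← emap_injective h']
      · exact fun h => Finset.mem_image_of_mem _ h
    rw [ising_eq, ising_eq, if_pos hX, if_pos hX]
    simp only [hmem]
    have hprod : ∀ ξ : Config d, ∏ y ∈ emap (x, i), spin (ξ y) = spin (ξ x) * spin (ξ (x + uv i)) :=
      fun ξ => Finset.prod_pair (ne_add_uv _ _)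
    rw [hprod, hprod]
    by_cases hxA : (x, i) ∈ A
    · have hne := hD x i hxA
      have hcr := (hA x i).mp hxA
      have hmeet : (emap (x, i) ∩ Λ).Nonempty := by
        by_cases hxS : x ∈ S
        · exact ⟨x, by simp [emap, hSΛ hxS]⟩
        · have : x + uv i ∈ S := by tauto
          exact ⟨x + uv i, by simp [emap, hSΛ this]⟩
      rw [if_pos hmeet, if_pos hmeet, if_pos hxA, spin_mul_of_ne hne]
      have : spin (flipOn S ω x) * spin (flipOn S ω (x + uv i)) = 1 := by
        by_cases hxS : x ∈ S
        · have : x + uv i ∉ S := by tauto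
          simp only [flipOn, hxS, this, if_true, if_false, spin_not]
          rw [neg_mul, spin_mul_of_ne hne]; simp
        · have : x + uv i ∈ S := by tauto
          simp only [flipOn, hxS, this, if_true, if_false, spin_not]
          rw [mul_neg, spin_mul_of_ne hne]; simp
      rw [this]; ring
    · have hcr : (x ∈ S ↔ x + uv i ∈ S) := by
        by_contra h; exact hxA ((hA x i).mpr h)
      have : spin (flipOn S ω x) * spin (flipOn S ω (x + uv i)) =
          spin (ω x) * spin (ω (x + uv i)) := by
        by_cases hxS : x ∈ S
        · have : x + uv i ∈ S := by tauto
          simp only [flipOn, hxS, this, if_true, spin_not]; ring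
        · have : x + uv i ∉ S := by tauto
          simp only [flipOn, hxS, this, if_false]
      rw [this, if_neg hxA, sub_self]
  · have : X ∉ A.image emap := by
      intro h
      obtain ⟨e, _, rfl⟩ := Finset.mem_image.mp h
      exact hX (edgeCond_emap e)
    rw [ising_eq, ising_eq, if_neg hX, if_neg hX, if_neg this]; simp

lemma energy_estimate (β : ℝ) {Ψ : Interaction d} (hL : IsLocal Ψ) (hT : TransInv Ψ)
    (hF : SpinFlipSymm Ψ) (hDS : DSummable Ψ)
    (Λ S : Finset (V d)) (hSΛ : S ⊆ Λ) (A : Finset (Edge d))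
    (hA : ∀ x i, (x, i) ∈ A ↔ ¬ (x ∈ S ↔ x + uv i ∈ S)) (ω : Config d)
    (hD : ∀ x i, (x, i) ∈ A → ω x ≠ ω (x + uv i)) :
    ham (Iadd (ising β) Ψ) Λ (flipOn S ω) + A.card * (2 * (β - 2 ^ d * dnorm Ψ))
      ≤ ham (Iadd (ising β) Ψ) Λ ω := by
  classical
  set Φ := Iadd (ising β) Ψ with hΦ
  have hLΦ : IsLocal Φ := iadd_local (ising_local β) hL
  have hTΦ : TransInv Φ := iadd_transInv (ising_transInv β) hT
  have hSΦ : AbsSummable Φ :=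
    iadd_absSummable (ising_local β) hL (ising_absSummable β) (absSummable_of_dSummable hDS)
  have s1 := summable_ham hLΦ hTΦ hSΦ Λ ω
  have s2 := summable_ham hLΦ hTΦ hSΦ Λ (flipOn S ω)
  -- crossing weights
  let w : Finset (V d) → ℝ := fun X =>
    if (∃ p ∈ X, p ∈ S) ∧ (∃ q ∈ X, q ∉ S) then supNorm Ψ X else 0
  obtain ⟨hw, hwle⟩ := cross_bound hT hDS A w
    (fun X => by simp only [w]; split_ifs; exacts [supNorm_nonneg _ _, le_rfl])
    (fun X hX => by
      simp only [w] at hX ⊢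
      split_ifs at hX ⊢ with h
      · refine ⟨le_rfl, ?_⟩
        obtain ⟨⟨p, hp, hpS⟩, ⟨q, hq, hqS⟩⟩ := h
        obtain ⟨x, i, hx, hb⟩ := exists_jump (fun y => if y ∈ S then (1 : ZMod 2) else 0) q _ p rfl
          (by simp [hpS, hqS])
        refine ⟨(x, i), ?_, p, hp, ?_⟩
        · rw [hA]
          intro hiff
          apply hx
          simp [hiff]
        · refine le_trans ?_ (distInf_le_diam hp hq)
          rw [distInf_le_iff]
          intro c
          refine le_trans ?_ ((distInf_le_iff p q _).mp le_rfl c)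
          have := hb c
          simp only
          omega
      · exact absurd rfl hX)
  let u : Finset (V d) → ℝ := fun X => if X ∈ A.image emap then 2 * β else 0
  have hu : HasSum u (A.card * (2 * β)) := by
    have h : HasSum u (∑ X ∈ A.image emap, u X) := hasSum_sum_of_ne_finset_zero
      (fun X hX => by simp only [u, if_neg hX])
    have he : ∑ X ∈ A.image emap, u X = A.card * (2 * β) := by
      rw [Finset.sum_congr rfl (g := fun _ => 2 * β) (fun X hX => by simp only [u, if_pos hX]),
        Finset.sum_const, Finset.card_image_of_injective _ emap_injective, nsmul_eq_mul]
    rwa [he] at h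
  have hpt : ∀ X, u X - 2 * w X ≤ (if (X ∩ Λ).Nonempty then Φ X ω else 0) -
      (if (X ∩ Λ).Nonempty then Φ X (flipOn S ω) else 0) := by
    intro X
    have h1 := ising_energy_term β Λ S hSΛ A hA ω hD X
    have h2 : - (2 * w X) ≤ (if (X ∩ Λ).Nonempty then Ψ X ω else 0) -
      (if (X ∩ Λ).Nonempty then Ψ X (flipOn S ω) else 0) := by
      by_cases hcr : (∃ p ∈ X, p ∈ S) ∧ (∃ q ∈ X, q ∉ S)
      · simp only [w, if_pos hcr]
        have a1 := abs_le.mp (abs_le_supNorm hL X ω)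
        have a2 := abs_le.mp (abs_le_supNorm hL X (flipOn S ω))
        have a3 := supNorm_nonneg Ψ X
        split_ifs <;> linarith
      · simp only [w, if_neg hcr]
        have : Ψ X (flipOn S ω) = Ψ X ω := by
          by_cases hp : ∃ p ∈ X, p ∈ S
          · have hq : ∀ q ∈ X, q ∈ S := by
              by_contra hcon
              push Not at hcon
              exact hcr ⟨hp, hcon⟩
            rw [← hF X ω]
            refine hL X _ _ fun x hx => ?_
            simp [flipOn, hq x hx]
          · push Not at hp
            refine hL X _ _ fun x hx => ?_
            simp [flipOn, hp x hx]
        rw [this]; simp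
    have h3 : ∀ ξ, (if (X ∩ Λ).Nonempty then Φ X ξ else 0) =
        (if (X ∩ Λ).Nonempty then ising β X ξ else 0) +
        (if (X ∩ Λ).Nonempty then Ψ X ξ else 0) := by
      intro ξ
      split_ifs
      · rfl
      · simp
    rw [h3, h3]
    simp only [u]
    linarith
  have hfin := Summable.tsum_le_tsum hpt (hu.summable.sub (hw.mul_left 2)) (s1.sub s2)
  rw [hu.summable.tsum_sub (hw.mul_left 2), s1.tsum_sub s2, hu.tsum_eq, tsum_mul_left] at hfin
  unfold ham
  linarith

/-! ### Part 5: the Peierls estimate -/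

/-- The number of steps available in the edge graph. -/
def stepCard (d : ℕ) : ℕ := Fintype.card ((Fin d → Fin 3) × Fin d)

lemma geom_quarter (m : ℕ) : ∑ n ∈ Finset.range m, (1 / 4 : ℝ) ^ (n + 1) ≤ 1 / 3 := by
  have : ∑ n ∈ Finset.range m, (1 / 4 : ℝ) ^ (n + 1) = (1 - (1 / 4) ^ m) / 3 := by
    induction m with
    | zero => simp
    | succ m ih => rw [Finset.sum_range_succ, ih]; ring
  rw [this]
  have : (0 : ℝ) ≤ (1 / 4) ^ m := by positivity
  linarith

lemma contour_sum (hd : 0 < d) (root : ℕ → Edge d) (F : Finset (Finset (Edge d)))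
    (hF : ∀ A ∈ F, CutConn eadj A ∧ ∃ k < A.card, root k ∈ A) (t : ℝ) (ht0 : 0 ≤ t)
    (ht : (stepCard d : ℝ) ^ 2 * t ≤ 1 / 8) : ∑ A ∈ F, t ^ A.card ≤ 1 / 3 := by
  classical
  set M := F.sup Finset.card with hM
  have hmaps : ∀ A ∈ F, A.card - 1 ∈ Finset.range (M + 1) := by
    intro A hA
    have := Finset.le_sup (f := Finset.card) hA
    rw [Finset.mem_range]; omega
  rw [← Finset.sum_fiberwise_of_maps_to hmaps]
  refine le_trans (Finset.sum_le_sum fun n _ => ?_) (geom_quarter (M + 1))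
  have hc : ∀ A ∈ F.filter (fun A => A.card - 1 = n), A.card = n + 1 := by
    intro A hA
    rw [Finset.mem_filter] at hA
    obtain ⟨_, k, hk, _⟩ := hF A hA.1
    omega
  have hcard := card_family_le (estep (d := d)) eadj
    (fun a b h => ⟨eadj_step a b h, eadj_step b a (eadj_symm h)⟩) root (n + 1)
    (F.filter (fun A => A.card - 1 = n)) (fun A hA => by
      have h1 := hc A hA
      obtain ⟨h2, h3⟩ := hF A (Finset.mem_filter.mp hA).1
      rw [h1] at h3
      exact ⟨h1, h2, h3⟩)
  rw [Finset.sum_congr rfl (g := fun _ => t ^ (n + 1)) (fun A hA => by rw [hc A hA]),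
    Finset.sum_const, nsmul_eq_mul]
  have hC1 : (1 : ℝ) ≤ stepCard d := by
    unfold stepCard
    have : Nonempty ((Fin d → Fin 3) × Fin d) := ⟨(fun _ => 0, ⟨0, hd⟩)⟩
    exact_mod_cast Fintype.card_pos
  have hcard' : ((F.filter (fun A => A.card - 1 = n)).card : ℝ) ≤
      (n + 1) * (stepCard d : ℝ) ^ (2 * n) := by
    have : ((F.filter (fun A => A.card - 1 = n)).card : ℝ) ≤
      ((n + 1) * (stepCard d) ^ (2 * (n + 1 - 1)) : ℕ) := by exact_mod_cast hcard
    simpa using this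
  have h2n : ((n : ℝ) + 1) ≤ 2 ^ (n + 1) := by
    have : n + 1 < 2 ^ (n + 1) := Nat.lt_two_pow_self
    exact_mod_cast this.le
  calc ((F.filter (fun A => A.card - 1 = n)).card : ℝ) * t ^ (n + 1)
      ≤ ((n + 1) * (stepCard d : ℝ) ^ (2 * n)) * t ^ (n + 1) := by gcongr
    _ ≤ (2 ^ (n + 1) * (stepCard d : ℝ) ^ (2 * (n + 1))) * t ^ (n + 1) := by
        gcongr
        omega
    _ = 2 ^ (n + 1) * ((stepCard d : ℝ) ^ 2 * t) ^ (n + 1) := by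
        rw [pow_mul, mul_pow]; ring
    _ ≤ 2 ^ (n + 1) * (1 / 8) ^ (n + 1) := by
        gcongr
    _ = (1 / 4) ^ (n + 1) := by rw [← mul_pow]; norm_num

/-- The box of radius `N`. -/
def box (N : ℕ) : Finset (V d) := Finset.Icc (fun _ => -(N : ℤ)) (fun _ => (N : ℤ))

lemma mem_box {N : ℕ} {x : V d} : x ∈ (box N : Finset (V d)) ↔ inBox N x := by
  unfold box inBox
  rw [Finset.mem_Icc]
  constructor
  · intro h c
    exact abs_le.mpr ⟨h.1 c, h.2 c⟩
  · intro h
    exact ⟨fun c => (abs_le.mp (h c)).1, fun c => (abs_le.mp (h c)).2⟩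

/-- Disagreement edges. -/
def disE (N : ℕ) (ω : Config d) : Finset (Edge d) :=
  ((box (N + 1)) ×ˢ Finset.univ).filter fun e => ω e.1 ≠ ω (e.1 + uv e.2)

lemma mem_disE {N : ℕ} {ω : Config d} (h : plusOutside (box N) ω) (x : V d) (i : Fin d) :
    (x, i) ∈ disE N ω ↔ ω x ≠ ω (x + uv i) := by
  unfold disE
  simp only [Finset.mem_filter, Finset.mem_product, Finset.mem_univ, and_true, and_iff_right_iff_imp]
  intro hne
  rw [mem_box]
  by_contra hb
  unfold inBox at hb
  push Not at hb
  obtain ⟨c, hc⟩ := hb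
  apply hne
  rw [h x, h (x + uv i)]
  · rw [mem_box]
    intro hb
    have := abs_le.mp (hb c)
    simp only [Pi.add_apply] at this
    push_cast at hc
    rcases lt_abs.mp hc with hc | hc <;> rcases uv_cases i c with h' | h' <;> omega
  · rw [mem_box]
    intro hb
    have := hb c
    push_cast at hc
    omega

lemma touch_disE {N : ℕ} {ω : Config d} (h : plusOutside (box N) ω) : Touch N (disE N ω) := by
  rintro ⟨x, i⟩ he
  rw [mem_disE h] at he
  by_contra hcon
  push Not at hcon
  rw [← mem_box, ← mem_box] at hcon
  exact he (by rw [h _ hcon.1, h _ hcon.2])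

/-- Minus indicator. -/
def zb (b : Bool) : ZMod 2 := if b then 0 else 1

lemma ind_disE {N : ℕ} {ω : Config d} (h : plusOutside (box N) ω) (x : V d) (i : Fin d) :
    ind (disE N ω) (x, i) = zb (ω x) + zb (ω (x + uv i)) := by
  unfold ind
  simp only [mem_disE h]
  generalize ω x = a
  generalize ω (x + uv i) = b
  cases a <;> cases b <;> decide

lemma closed_disE {N : ℕ} {ω : Config d} (h : plusOutside (box N) ω) : EClosed (disE N ω) := by
  intro x i j
  rw [ind_disE h, ind_disE h, ind_disE h, ind_disE h]
  have : x + uv i + uv j = x + uv j + uv i := by abel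
  rw [this]
  generalize zb (ω x) = a
  generalize zb (ω (x + uv i)) = b
  generalize zb (ω (x + uv j + uv i)) = c
  generalize zb (ω (x + uv j)) = e
  revert a b c e
  decide

lemma gf_disE (i0 i1 : Fin d) (h01 : i1 ≠ i0) {N : ℕ} {ω : Config d}
    (h : plusOutside (box N) ω) (v : V d) : gf i0 (N + 1) (disE N ω) v = zb (ω v) := by
  have ht := touch_disE h
  have hcl := closed_disE h
  have key : ∀ m : ℕ, gf i0 (N + 1) (disE N ω) v + zb (ω v) =
      gf i0 (N + 1) (disE N ω) (v + Pi.single i0 (m : ℤ)) + zb (ω (v + Pi.single i0 (m : ℤ))) := by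
    intro m
    induction m with
    | zero => simp
    | succ m ih =>
      rw [ih, gf_dir0 i0 (N + 1) _ (ht.lt i0), ind_disE h]
      have e1 : v + Pi.single i0 (m : ℤ) + uv i0 = v + Pi.single i0 ((m + 1 : ℕ) : ℤ) := by
        rw [add_assoc]; congr 1
        funext c
        by_cases hc : c = i0
        · subst hc; simp [uv]
        · simp [uv, hc]
      rw [e1]
      generalize zb (ω (v + Pi.single i0 ((m + 1 : ℕ) : ℤ))) = a
      generalize zb (ω (v + Pi.single i0 (m : ℤ))) = b
      generalize gf i0 _ _ _ = c
      revert a b c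
      decide
  have hout : ¬ inBox (N : ℤ) (v + Pi.single i0 (((N : ℤ) + 1 + |v i0|).toNat : ℤ)) := by
    intro hb
    have := abs_le.mp (hb i0)
    simp only [Pi.add_apply, Pi.single_eq_same] at this
    have h1 := neg_abs_le (v i0)
    omega
  have hk := key ((N : ℤ) + 1 + |v i0|).toNat
  have hω : ω (v + Pi.single i0 (((N : ℤ) + 1 + |v i0|).toNat : ℤ)) = true :=
    h _ (by rw [mem_box]; exact hout)
  rw [gf_outside i0 i1 h01 ht hcl _ hout, hω] at hk
  have h0 : zb true = 0 := rfl
  rw [h0] at hk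
  clear key hout hω
  have : ∀ c b : ZMod 2, c + b = 0 + 0 → c = b := by decide
  exact this _ _ hk

lemma plusOutside_fill (Λ : Finset (V d)) (f : ↥Λ → Bool) : plusOutside Λ (fill Λ f plusC) := by
  intro x hx
  simp [fill, hx, plusC]

/-- Flip on `S` inside `Λ`. -/
def flipIn (Λ S : Finset (V d)) (f : ↥Λ → Bool) : ↥Λ → Bool :=
  fun x => if x.1 ∈ S then !(f x) else f x

lemma flipIn_invol (Λ S : Finset (V d)) : Function.Involutive (flipIn Λ S) := by
  intro f
  funext x
  unfold flipIn
  by_cases h : x.1 ∈ S <;> simp [h]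

lemma fill_flipIn (Λ S : Finset (V d)) (hS : S ⊆ Λ) (f : ↥Λ → Bool) (η : Config d) :
    fill Λ (flipIn Λ S f) η = flipOn S (fill Λ f η) := by
  funext x
  unfold fill flipIn flipOn
  by_cases h : x ∈ Λ
  · simp [h]
  · have : x ∉ S := fun h' => h (hS h')
    simp [h, this]

open scoped Classical in
lemma peierls (hd : 2 ≤ d) (β : ℝ) {Ψ : Interaction d} (hL : IsLocal Ψ) (hT : TransInv Ψ)
    (hF : SpinFlipSymm Ψ) (hDS : DSummable Ψ)
    (hβ : (stepCard d : ℝ) ^ 2 * Real.exp (-(2 * (β - 2 ^ d * dnorm Ψ))) ≤ 1 / 8)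
    (N : ℕ) (v : V d) :
    ∑ f : ↥(box N : Finset (V d)) → Bool, finGibbs (Iadd (ising β) Ψ) (box N) plusC f *
      (if fill (box N) f plusC v = false then 1 else 0) ≤ 1 / 3 := by
  set Φ := Iadd (ising β) Ψ with hΦ
  set Λ : Finset (V d) := box N with hΛ
  set c := 2 * (β - 2 ^ d * dnorm Ψ) with hc
  let i0 : Fin d := ⟨0, by omega⟩
  let i1 : Fin d := ⟨1, by omega⟩
  have h01 : i1 ≠ i0 := by simp [i0, i1]
  let F : Finset (Finset (Edge d)) :=
    (((box (N + 1) : Finset (V d)) ×ˢ (Finset.univ : Finset (Fin d))).powerset).filter fun A =>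
      Touch N A ∧ EClosed A ∧ CutConn eadj A ∧ gf i0 (N + 1) A v = 1
  have hFsum : ∑ A ∈ F, Real.exp (-c) ^ A.card ≤ 1 / 3 := by
    refine contour_sum (by omega) (fun k => (v + Pi.single i0 (k : ℤ), i0)) F ?_ _
      (Real.exp_pos _).le hβ
    intro A hA
    obtain ⟨_, h1, h2, h3, h4⟩ := Finset.mem_filter.mp hA
    exact ⟨h3, exists_root i0 i1 h01 h1 h2 v h4⟩
  have hA : ∀ A ∈ F, ∑ f : ↥Λ → Bool, (if A ⊆ disE N (fill Λ f plusC) then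
      Real.exp (-(ham Φ Λ (fill Λ f plusC))) else 0) ≤ Real.exp (-c) ^ A.card * gibbsZ Φ Λ plusC := by
    intro A hA
    obtain ⟨_, h1, h2, h3, h4⟩ := Finset.mem_filter.mp hA
    let S : Finset (V d) := Λ.filter fun x => gf i0 (N + 1) A x = 1
    have hSΛ : S ⊆ Λ := Finset.filter_subset _ _
    have hmS : ∀ x, x ∈ S ↔ gf i0 (N + 1) A x = 1 := by
      intro x
      simp only [S, Finset.mem_filter, and_iff_right_iff_imp]
      intro hx
      by_contra hb
      rw [hΛ, mem_box] at hb
      rw [gf_outside i0 i1 h01 h1 h2 x hb] at hx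
      exact absurd hx (by decide)
    have hAS : ∀ x i, (x, i) ∈ A ↔ ¬ (x ∈ S ↔ x + uv i ∈ S) := by
      intro x i
      rw [hmS, hmS, gf_dir i0 (N + 1) A (h1.lt i0) h2 x i]
      rcases zmod2_cases (gf i0 (N + 1) A (x + uv i)) with h | h <;> rw [h] <;>
        by_cases hm : (x, i) ∈ A <;> simp [ind, hm]
    have hterm : ∀ f : ↥Λ → Bool, (if A ⊆ disE N (fill Λ f plusC) then
        Real.exp (-(ham Φ Λ (fill Λ f plusC))) else 0) ≤
        Real.exp (-c) ^ A.card * Real.exp (-(ham Φ Λ (fill Λ (flipIn Λ S f) plusC))) := by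
      intro f
      split_ifs with hsub
      · have hE := energy_estimate β hL hT hF hDS Λ S hSΛ A hAS (fill Λ f plusC)
          (fun x i hxi => (mem_disE (plusOutside_fill _ f) x i).mp (hsub hxi))
        rw [← Real.exp_nat_mul, ← Real.exp_add, fill_flipIn Λ S hSΛ]
        apply Real.exp_le_exp.mpr
        rw [← hc] at hE
        linarith
      · positivity
    refine (Finset.sum_le_sum fun f _ => hterm f).trans ?_
    rw [← Finset.mul_sum]
    refine mul_le_mul_of_nonneg_left (le_of_eq ?_) (by positivity)
    exact Equiv.sum_comp ((flipIn_invol Λ S).toPerm)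
      (fun f => Real.exp (-(ham Φ Λ (fill Λ f plusC))))
  have hZ := gibbsZ_pos Φ Λ plusC
  have hbad : ∑ f : ↥Λ → Bool, Real.exp (-(ham Φ Λ (fill Λ f plusC))) *
      (if fill Λ f plusC v = false then 1 else 0) ≤
      ∑ A ∈ F, ∑ f : ↥Λ → Bool, (if A ⊆ disE N (fill Λ f plusC) then
      Real.exp (-(ham Φ Λ (fill Λ f plusC))) else 0) := by
    rw [Finset.sum_comm]
    refine Finset.sum_le_sum fun f _ => ?_
    have hnn : ∀ A ∈ F, 0 ≤ (if A ⊆ disE N (fill Λ f plusC) then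
      Real.exp (-(ham Φ Λ (fill Λ f plusC))) else 0) := fun A _ => by
        split_ifs <;> positivity
    by_cases hv : fill Λ f plusC v = false
    · have hp : plusOutside (box N) (fill Λ f plusC) := plusOutside_fill _ f
      have hg := gf_disE i0 i1 h01 hp v
      rw [hv] at hg
      obtain ⟨A, hAD, hA1, hA2, hA3⟩ := exists_contour i0 (N + 1) _ (closed_disE hp) v hg
      have hAF : A ∈ F := by
        simp only [F, Finset.mem_filter, Finset.mem_powerset]
        refine ⟨hAD.trans (Finset.filter_subset _ _), fun e he => touch_disE hp e (hAD he),
          hA1, hA2, hA3⟩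
      have := Finset.single_le_sum hnn hAF
      rw [if_pos hAD] at this
      simpa [hv] using this
    · simp only [hv]
      simpa using Finset.sum_nonneg hnn
  unfold finGibbs
  simp_rw [div_mul_eq_mul_div]
  rw [← Finset.sum_div, div_le_iff₀ hZ]
  refine hbad.trans ((Finset.sum_le_sum hA).trans ?_)
  rw [← Finset.sum_mul]
  exact mul_le_mul_of_nonneg_right hFsum hZ.le

/-! ### Consistency and covariance of finite Gibbs states -/

lemma ham_sub {Φ : Interaction d} (hL : IsLocal Φ) (hT : TransInv Φ) (hS : AbsSummable Φ)
    {Δ Λ : Finset (V d)} (h : Δ ⊆ Λ) {ω ω' : Config d} (hω : ∀ x ∉ Δ, ω x = ω' x) :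
    ham Φ Λ ω - ham Φ Δ ω = ham Φ Λ ω' - ham Φ Δ ω' := by
  unfold ham
  rw [← (summable_ham hL hT hS Λ ω).tsum_sub (summable_ham hL hT hS Δ ω),
    ← (summable_ham hL hT hS Λ ω').tsum_sub (summable_ham hL hT hS Δ ω')]
  congr 1
  funext X
  by_cases hX : (X ∩ Δ).Nonempty
  · have : (X ∩ Λ).Nonempty := hX.mono (Finset.inter_subset_inter_left h)
    simp [hX, this]
  · have : Φ X ω = Φ X ω' := hL X _ _ fun x hx => hω x fun hxΔ =>
      hX ⟨x, Finset.mem_inter.mpr ⟨hx, hxΔ⟩⟩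
    rw [this]

/-- Overwrite `g` on `Δ` by `h`. -/
def ovr (Λ Δ : Finset (V d)) (g : ↥Λ → Bool) (h : ↥Δ → Bool) : ↥Λ → Bool :=
  fun x => if hx : x.1 ∈ Δ then h ⟨x.1, hx⟩ else g x

/-- Restriction. -/
def restr {Λ Δ : Finset (V d)} (hs : Δ ⊆ Λ) (g : ↥Λ → Bool) : ↥Δ → Bool :=
  fun x => g ⟨x.1, hs x.2⟩

lemma fill_over {Λ Δ : Finset (V d)} (hs : Δ ⊆ Λ) (g : ↥Λ → Bool) (h : ↥Δ → Bool) (η : Config d) :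
    fill Δ h (fill Λ g η) = fill Λ (ovr Λ Δ g h) η := by
  funext x
  by_cases hx : x ∈ Δ
  · simp [fill, ovr, hx, hs hx]
  · by_cases hx' : x ∈ Λ <;> simp [fill, ovr, hx, hx']

lemma over_over {Λ Δ : Finset (V d)} (g : ↥Λ → Bool) (h h' : ↥Δ → Bool) :
    ovr Λ Δ (ovr Λ Δ g h) h' = ovr Λ Δ g h' := by
  funext x
  by_cases hx : x.1 ∈ Δ <;> simp [ovr, hx]

lemma over_restr {Λ Δ : Finset (V d)} (hs : Δ ⊆ Λ) (g : ↥Λ → Bool) :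
    ovr Λ Δ g (restr hs g) = g := by
  funext x
  by_cases hx : x.1 ∈ Δ <;> simp [ovr, restr, hx]

lemma restr_over {Λ Δ : Finset (V d)} (hs : Δ ⊆ Λ) (g : ↥Λ → Bool) (h : ↥Δ → Bool) :
    restr hs (ovr Λ Δ g h) = h := by
  funext x
  simp [ovr, restr]

lemma mem_cyl_fill {Λ Δ : Finset (V d)} (hs : Δ ⊆ Λ) (g : ↥Λ → Bool) (f : ↥Δ → Bool)
    (η : Config d) : fill Λ g η ∈ cyl Δ f ↔ restr hs g = f := by
  unfold cyl
  rw [Set.mem_ofPred_eq, funext_iff]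
  constructor
  · intro h x
    have := h x.1 x.2
    simpa [fill, restr, hs x.2] using this
  · intro h x hx
    have := h ⟨x, hx⟩
    simpa [fill, restr, hs hx] using this

open scoped Classical in
lemma resample {Λ Δ : Finset (V d)} (hs : Δ ⊆ Λ) (w : (↥Λ → Bool) → ℝ) (hw : ∀ g, 0 < w g)
    (f : ↥Δ → Bool) :
    ∑ g : ↥Λ → Bool, w g * (if restr hs g = f then 1 else 0) =
      ∑ g : ↥Λ → Bool, w g * (w (ovr Λ Δ g f) / ∑ h : ↥Δ → Bool, w (ovr Λ Δ g h)) := by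
  set D : (↥Λ → Bool) → ℝ := fun g => ∑ h : ↥Δ → Bool, w (ovr Λ Δ g h) with hD
  have hDpos : ∀ g, 0 < D g := fun g => Finset.sum_pos (fun h _ => hw _) Finset.univ_nonempty
  have hDo : ∀ g h, D (ovr Λ Δ g h) = D g := by
    intro g h
    simp only [hD, over_over]
  have e1 : ∑ g : ↥Λ → Bool, w g * (if restr hs g = f then 1 else 0) =
      ∑ q : (↥Λ → Bool) × (↥Δ → Bool),
        w q.1 * (if restr hs q.1 = f then 1 else 0) * w (ovr Λ Δ q.1 q.2) / D q.1 := by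
    rw [Fintype.sum_prod_type]
    refine Finset.sum_congr rfl fun g _ => ?_
    have := (hDpos g).ne'
    by_cases hg : restr hs g = f
    · simp only [hg, if_true]
      rw [← Finset.sum_div, ← Finset.mul_sum]
      change _ = _ * D g / D g
      field_simp
    · simp [hg]
  have e2 : ∑ g : ↥Λ → Bool, w g * (w (ovr Λ Δ g f) / D g) =
      ∑ q : (↥Λ → Bool) × (↥Δ → Bool),
        w (ovr Λ Δ q.1 q.2) * (if q.2 = f then 1 else 0) * w q.1 / D q.1 := by
    rw [Fintype.sum_prod_type]
    refine Finset.sum_congr rfl fun g _ => ?_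
    rw [Finset.sum_eq_single f]
    · simp; ring
    · intro h _ hh; simp [hh]
    · simp
  rw [e1]
  change _ = ∑ g : ↥Λ → Bool, w g * (w (ovr Λ Δ g f) / D g)
  rw [e2]
  have hinv : Function.Involutive (fun q : (↥Λ → Bool) × (↥Δ → Bool) =>
      (ovr Λ Δ q.1 q.2, restr hs q.1)) := by
    rintro ⟨g, h⟩
    simp [over_over, over_restr, restr_over]
  refine Fintype.sum_bijective _ hinv.bijective _ _ ?_
  rintro ⟨g, h⟩
  simp only [over_over, over_restr, hDo]

lemma finGibbs_weight {Φ : Interaction d} (hL : IsLocal Φ) (hT : TransInv Φ) (hS : AbsSummable Φ)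
    {Δ Λ : Finset (V d)} (hs : Δ ⊆ Λ) (g : ↥Λ → Bool) (η : Config d) (f : ↥Δ → Bool) :
    finGibbs Φ Δ (fill Λ g η) f =
      Real.exp (-(ham Φ Λ (fill Λ (ovr Λ Δ g f) η))) /
        ∑ h : ↥Δ → Bool, Real.exp (-(ham Φ Λ (fill Λ (ovr Λ Δ g h) η))) := by
  set ξ := fill Λ g η with hξ
  have key : ∀ h : ↥Δ → Bool, Real.exp (-(ham Φ Λ (fill Λ (ovr Λ Δ g h) η))) =
      Real.exp (-(ham Φ Λ ξ - ham Φ Δ ξ)) * Real.exp (-(ham Φ Δ (fill Δ h ξ))) := by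
    intro h
    rw [← Real.exp_add, ← fill_over hs]
    congr 1
    have := ham_sub hL hT hS hs (ω := fill Δ h ξ) (ω' := ξ) (fun x hx => by simp [fill, hx])
    linarith
  simp_rw [key]
  rw [← Finset.mul_sum, mul_div_mul_left _ _ (Real.exp_pos _).ne']
  rfl

open scoped Classical in
lemma consistency {Φ : Interaction d} (hL : IsLocal Φ) (hT : TransInv Φ) (hS : AbsSummable Φ)
    {Δ Λ : Finset (V d)} (hs : Δ ⊆ Λ) (η : Config d) (f : ↥Δ → Bool) :
    ∑ g : ↥Λ → Bool, finGibbs Φ Λ η g * (if fill Λ g η ∈ cyl Δ f then 1 else 0) =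
      ∑ g : ↥Λ → Bool, finGibbs Φ Λ η g * finGibbs Φ Δ (fill Λ g η) f := by
  simp_rw [mem_cyl_fill hs, finGibbs_weight hL hT hS hs]
  have := resample hs (fun g => Real.exp (-(ham Φ Λ (fill Λ g η)))) (fun g => Real.exp_pos _) f
  have h2 := congrArg (fun t => t / gibbsZ Φ Λ η) this
  simp only [Finset.sum_div] at h2
  unfold finGibbs
  convert h2 using 1
  · refine Finset.sum_congr rfl fun g _ => by ring
  · refine Finset.sum_congr rfl fun g _ => by ring

/-- A symmetry of the configuration space. -/
def sym (b : Bool) (p : V d ≃ V d) (ω : Config d) : Config d := fun x => xor b (ω (p x))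

/-- Transport of local configurations. -/
def symmE (b : Bool) (p : V d ≃ V d) (Δ : Finset (V d)) :
    (↥Δ → Bool) ≃ (↥(Δ.map p.toEmbedding) → Bool) where
  toFun f := fun y => xor b (f ⟨p.symm y.1, by
    obtain ⟨x, hx, h⟩ := Finset.mem_map.mp y.2
    rw [← h]; simpa using hx⟩)
  invFun g := fun x => xor b (g ⟨p x.1, Finset.mem_map.mpr ⟨x.1, x.2, rfl⟩⟩)
  left_inv f := by
    funext x
    cases b <;> simp
  right_inv g := by
    funext y
    cases b <;> simp

lemma symm_fill (b : Bool) (p : V d ≃ V d) (Δ : Finset (V d)) (f : ↥Δ → Bool) (η : Config d) :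
    sym b p (fill (Δ.map p.toEmbedding) (symmE b p Δ f) η) = fill Δ f (sym b p η) := by
  funext x
  by_cases hx : x ∈ Δ
  · cases b <;> simp [sym, fill, symmE, hx]
  · cases b <;> simp [sym, fill, hx]

lemma symm_cyl (b : Bool) (p : V d ≃ V d) (Δ : Finset (V d)) (f : ↥Δ → Bool) (ω : Config d) :
    sym b p ω ∈ cyl Δ f ↔ ω ∈ cyl (Δ.map p.toEmbedding) (symmE b p Δ f) := by
  unfold cyl
  simp only [Set.mem_ofPred_eq]
  constructor
  · intro h y hy
    obtain ⟨x, hx, rfl⟩ := Finset.mem_map.mp hy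
    have := h x hx
    cases b <;> simp_all [sym, symmE]
  · intro h x hx
    have := h (p x) (Finset.mem_map.mpr ⟨x, hx, rfl⟩)
    cases b <;> simp_all [sym, symmE]

lemma symm_ham {Φ : Interaction d} {b : Bool} {p : V d ≃ V d}
    (hΦ : ∀ X ω, Φ X (sym b p ω) = Φ (X.map p.toEmbedding) ω) (Δ : Finset (V d)) (ω : Config d) :
    ham Φ Δ (sym b p ω) = ham Φ (Δ.map p.toEmbedding) ω := by
  unfold ham
  rw [← (Equiv.finsetCongr p).tsum_eq (fun X => if (X ∩ Δ.map p.toEmbedding).Nonempty then Φ X ω else 0)]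
  congr 1
  funext X
  rw [hΦ, Equiv.finsetCongr_apply, ← Finset.map_inter]
  simp only [Finset.map_nonempty]

lemma symm_finGibbs {Φ : Interaction d} {b : Bool} {p : V d ≃ V d}
    (hΦ : ∀ X ω, Φ X (sym b p ω) = Φ (X.map p.toEmbedding) ω) (Δ : Finset (V d)) (η : Config d)
    (f : ↥Δ → Bool) :
    finGibbs Φ Δ (sym b p η) f = finGibbs Φ (Δ.map p.toEmbedding) η (symmE b p Δ f) := by
  unfold finGibbs gibbsZ
  simp_rw [← symm_fill b p Δ, symm_ham hΦ]
  congr 1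
  exact (symmE b p Δ).sum_comp
    (fun g => Real.exp (-(ham Φ (Δ.map p.toEmbedding) (fill (Δ.map p.toEmbedding) g η))))

lemma translate_symm (a : V d) : (translate a : Config d → Config d) = sym false (Equiv.addRight a) := by
  funext ω x
  simp [translate, sym]

lemma transInv_symm {Φ : Interaction d} (hT : TransInv Φ) (a : V d) (X : Finset (V d)) (ω : Config d) :
    Φ X (sym false (Equiv.addRight a) ω) = Φ (X.map (Equiv.addRight a).toEmbedding) ω := by
  rw [← hT a (X.map (Equiv.addRight a).toEmbedding) ω, ← translate_symm]
  congr 1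
  ext x
  simp only [Finset.mem_image, Finset.mem_map_equiv]
  constructor
  · intro h
    exact ⟨x + a, by simpa using h, by simp⟩
  · rintro ⟨y, hy, rfl⟩
    simpa [sub_eq_add_neg] using hy

/-- Global spin flip. -/
def gflip (ω : Config d) : Config d := fun x => !(ω x)

lemma gflip_symm : (gflip : Config d → Config d) = sym true (Equiv.refl _) := by
  funext ω x
  simp [gflip, sym]

lemma flip_symm {Φ : Interaction d} (hF : SpinFlipSymm Φ) (X : Finset (V d)) (ω : Config d) :
    Φ X (sym true (Equiv.refl _) ω) = Φ (X.map (Equiv.refl _).toEmbedding) ω := by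
  rw [← gflip_symm]
  have : X.map (Equiv.refl (V d)).toEmbedding = X := by ext; simp
  rw [this]
  exact hF X ω

/-! ### Infinite-volume limit -/

/-- Unnormalised contribution of the shift `a`. -/
def GG (Φ : Interaction d) (N : ℕ) (F : Config d → ℝ) (a : V d) : ℝ :=
  ∑ g : ↥(box (2 * N) : Finset (V d)) → Bool,
    finGibbs Φ (box (2 * N)) plusC g * F (translate a (fill (box (2 * N)) g plusC))

/-- Averaged finite-volume functional. -/
def JJ (Φ : Interaction d) (N : ℕ) (F : Config d → ℝ) : ℝ :=
  ((box N : Finset (V d)).card : ℝ)⁻¹ * ∑ a ∈ (box N : Finset (V d)), GG Φ N F a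

/-- Averaged finite-volume measure. -/
def muN (Φ : Interaction d) (N : ℕ) : Measure (Config d) :=
  ∑ a ∈ (box N : Finset (V d)), ∑ g : ↥(box (2 * N) : Finset (V d)) → Bool,
    ENNReal.ofReal (((box N : Finset (V d)).card : ℝ)⁻¹ * finGibbs Φ (box (2 * N)) plusC g) •
      Measure.dirac (translate a (fill (box (2 * N)) g plusC))

lemma finGibbs_nonneg (Φ : Interaction d) (Λ : Finset (V d)) (η : Config d) (f : ↥Λ → Bool) :
    0 ≤ finGibbs Φ Λ η f := div_nonneg (Real.exp_pos _).le (gibbsZ_pos Φ Λ η).le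

lemma finGibbs_sum (Φ : Interaction d) (Λ : Finset (V d)) (η : Config d) :
    ∑ f : ↥Λ → Bool, finGibbs Φ Λ η f = 1 := by
  unfold finGibbs
  rw [← Finset.sum_div]
  exact div_self (gibbsZ_pos Φ Λ η).ne'

lemma box_card (N : ℕ) : (box N : Finset (V d)).card = (2 * N + 1) ^ d := by
  unfold box
  rw [Pi.card_Icc]
  simp only [Int.card_Icc, Finset.prod_const, Finset.card_univ, Fintype.card_fin]
  congr 1
  omega

lemma box_card_pos (N : ℕ) : (0 : ℝ) < ((box N : Finset (V d)).card : ℝ) := by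
  rw [box_card]; positivity

lemma continuous_translate (a : V d) : Continuous (translate a : Config d → Config d) :=
  continuous_pi fun x => continuous_apply (x + a)

lemma continuous_gflip : Continuous (gflip : Config d → Config d) :=
  continuous_pi fun x => (continuous_of_discreteTopology (f := Bool.not)).comp (continuous_apply x)

lemma JJ_one (Φ : Interaction d) (N : ℕ) : JJ Φ N (fun _ => 1) = 1 := by
  unfold JJ GG
  simp only [mul_one, finGibbs_sum, Finset.sum_const, nsmul_eq_mul]
  exact inv_mul_cancel₀ (box_card_pos N).ne'

lemma integrable_of_continuous (μ : Measure (Config d)) [IsFiniteMeasure μ] {F : Config d → ℝ}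
    (hF : Continuous F) : Integrable F μ :=
  (BoundedContinuousFunction.mkOfCompact ⟨F, hF⟩).integrable μ

lemma muN_finite (Φ : Interaction d) (N : ℕ) : IsFiniteMeasure (muN Φ N) := by
  constructor
  unfold muN
  simp only [Measure.coe_finsetSum, Finset.sum_apply, Measure.smul_apply, smul_eq_mul,
    measure_univ, mul_one]
  exact ENNReal.sum_lt_top.mpr fun a _ => ENNReal.sum_lt_top.mpr fun g _ => ENNReal.ofReal_lt_top

lemma integral_muN (Φ : Interaction d) (N : ℕ) {F : Config d → ℝ} (hF : Continuous F) :
    ∫ ω, F ω ∂(muN Φ N) = JJ Φ N F := by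
  unfold muN JJ GG
  have hi : ∀ (c : ℝ) (ω : Config d),
      Integrable F (ENNReal.ofReal c • Measure.dirac ω) := fun c ω =>
    (integrable_of_continuous _ hF).smul_measure ENNReal.ofReal_ne_top
  rw [integral_finsetSum_measure, Finset.mul_sum]
  · refine Finset.sum_congr rfl fun a _ => ?_
    rw [integral_finsetSum_measure, Finset.mul_sum]
    · refine Finset.sum_congr rfl fun g _ => ?_
      rw [integral_smul_measure, integral_dirac, ENNReal.toReal_ofReal, smul_eq_mul, mul_assoc]
      exact mul_nonneg (inv_nonneg.mpr (box_card_pos N).le) (finGibbs_nonneg _ _ _ _)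
    · intro g _; exact hi _ _
  · intro a _
    rw [integrable_finsetSum_measure]
    intro g _; exact hi _ _

lemma muN_prob (Φ : Interaction d) (N : ℕ) : IsProbabilityMeasure (muN Φ N) := by
  have := muN_finite Φ N
  have h := integral_muN Φ N (F := fun _ => 1) continuous_const
  rw [JJ_one] at h
  simp only [integral_const, smul_eq_mul, mul_one] at h
  constructor
  rw [measureReal_def] at h
  rw [← ENNReal.toReal_eq_one_iff]
  exact h

lemma exists_limit (Φ : Interaction d) : ∃ (σ : Measure (Config d)) (L : Filter ℕ),
    IsProbabilityMeasure σ ∧ L.NeBot ∧ L ≤ atTop ∧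
      ∀ F : Config d → ℝ, Continuous F → Tendsto (fun N => JJ Φ N F) L (𝓝 (∫ ω, F ω ∂σ)) := by
  let m : ℕ → ProbabilityMeasure (Config d) := fun N => ⟨muN Φ N, muN_prob Φ N⟩
  let U : Ultrafilter (ProbabilityMeasure (Config d)) := (hyperfilter ℕ).map m
  obtain ⟨σ, -, hσ⟩ := isCompact_univ.ultrafilter_le_nhds U (by simp)
  refine ⟨σ, hyperfilter ℕ, inferInstance, inferInstance, Nat.hyperfilter_le_atTop, ?_⟩
  intro F hF
  have ht : Tendsto m (hyperfilter ℕ) (𝓝 σ) := hσ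
  rw [ProbabilityMeasure.tendsto_iff_forall_integral_tendsto] at ht
  have := ht (BoundedContinuousFunction.mkOfCompact ⟨F, hF⟩)
  refine this.congr fun N => ?_
  exact integral_muN Φ N hF

open scoped Classical in
lemma continuous_cyl (Δ : Finset (V d)) (f : ↥Δ → Bool) :
    Continuous (fun ω : Config d => if ω ∈ cyl Δ f then (1 : ℝ) else 0) := by
  have h1 : Continuous (fun ω : Config d => (fun x : ↥Δ => ω x.1)) :=
    continuous_pi fun x => continuous_apply x.1
  have h2 : Continuous (fun r : ↥Δ → Bool => if r = f then (1 : ℝ) else 0) :=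
    continuous_of_discreteTopology
  convert h2.comp h1 using 1
  funext ω
  have : ω ∈ cyl Δ f ↔ (fun x : ↥Δ => ω x.1) = f := by
    unfold cyl
    rw [Set.mem_ofPred_eq, funext_iff]
    exact ⟨fun h x => h x.1 x.2, fun h x hx => h ⟨x, hx⟩⟩
  simp [this]

lemma measurable_cyl (Δ : Finset (V d)) (f : ↥Δ → Bool) : MeasurableSet (cyl Δ f) := by
  classical
  have := (continuous_cyl Δ f).measurable (measurableSet_singleton (1 : ℝ))
  convert this using 1
  ext ω
  by_cases h : ω ∈ cyl Δ f <;> simp [h]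

open scoped Classical in
lemma JJ_dlr {Φ : Interaction d} (hL : IsLocal Φ) (hT : TransInv Φ) (hS : AbsSummable Φ)
    (Δ : Finset (V d)) (f : ↥Δ → Bool) (N : ℕ) (hN : Δ ⊆ box N) :
    JJ Φ N (fun ω => if ω ∈ cyl Δ f then (1 : ℝ) else 0) =
      JJ Φ N (fun ω => finGibbs Φ Δ ω f) := by
  unfold JJ
  congr 1
  refine Finset.sum_congr rfl fun a ha => ?_
  unfold GG
  have hs : Δ.map (Equiv.addRight a).toEmbedding ⊆ box (2 * N) := by
    intro y hy
    obtain ⟨x, hx, rfl⟩ := Finset.mem_map.mp hy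
    have h1 := mem_box.mp (hN hx)
    have h2 := mem_box.mp ha
    rw [mem_box]
    intro c
    have h3 := abs_le.mp (h1 c)
    have h4 := abs_le.mp (h2 c)
    simp only [Equiv.coe_toEmbedding, Equiv.coe_addRight, Pi.add_apply]
    rw [abs_le]
    push_cast
    omega
  have := consistency hL hT hS hs plusC (symmE false (Equiv.addRight a) Δ f)
  simp only [translate_symm, symm_cyl, symm_finGibbs (transInv_symm hT a)] at this ⊢
  exact this

lemma exists_box (Δ : Finset (V d)) : ∃ k : ℕ, Δ ⊆ box k := by
  refine ⟨Δ.sup fun x => Finset.univ.sup fun c => (x c).natAbs, fun x hx => ?_⟩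
  rw [mem_box]
  intro c
  have h1 : (x c).natAbs ≤ Finset.univ.sup fun c => (x c).natAbs :=
    Finset.le_sup (f := fun c => (x c).natAbs) (Finset.mem_univ c)
  have h2 := Finset.le_sup (f := fun x : V d => Finset.univ.sup fun c => (x c).natAbs) hx
  rw [abs_le]
  omega

lemma box_mono {k N : ℕ} (h : k ≤ N) : (box k : Finset (V d)) ⊆ box N := by
  intro x hx
  rw [mem_box] at hx ⊢
  intro c
  have := hx c
  omega

lemma limit_gibbs {Φ : Interaction d} (hL : IsLocal Φ) (hT : TransInv Φ) (hS : AbsSummable Φ)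
    {σ : Measure (Config d)} {L : Filter ℕ} (hσ : IsProbabilityMeasure σ) [L.NeBot]
    (hLt : L ≤ atTop)
    (h : ∀ F : Config d → ℝ, Continuous F → Tendsto (fun N => JJ Φ N F) L (𝓝 (∫ ω, F ω ∂σ))) :
    ∀ (Δ : Finset (V d)) (f : ↥Δ → Bool), (σ (cyl Δ f)).toReal = ∫ η, finGibbs Φ Δ η f ∂σ := by
  classical
  intro Δ f
  have h1 := h _ (continuous_cyl Δ f)
  have h2 := h _ (continuous_finGibbs hL hT hS Δ f)
  have heq : ∀ᶠ N in L, JJ Φ N (fun ω => if ω ∈ cyl Δ f then (1 : ℝ) else 0) =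
      JJ Φ N (fun ω => finGibbs Φ Δ ω f) := by
    obtain ⟨k, hk⟩ := exists_box Δ
    refine hLt ?_
    filter_upwards [eventually_ge_atTop k] with N hN
    exact JJ_dlr hL hT hS Δ f N (hk.trans (box_mono hN))
  have h3 := tendsto_nhds_unique (h1.congr' heq) h2
  rw [← h3]
  have : (fun ω : Config d => if ω ∈ cyl Δ f then (1 : ℝ) else 0) = (cyl Δ f).indicator 1 := by
    funext ω
    simp [Set.indicator]
  rw [this, integral_indicator_one (measurable_cyl Δ f)]
  rfl

lemma GG_bound (Φ : Interaction d) (N : ℕ) {F : Config d → ℝ} {M : ℝ} (hM : ∀ ω, |F ω| ≤ M)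
    (a : V d) : |GG Φ N F a| ≤ M := by
  unfold GG
  refine (Finset.abs_sum_le_sum_abs _ _).trans ?_
  have : ∀ g ∈ (Finset.univ : Finset (↥(box (2 * N) : Finset (V d)) → Bool)),
      |finGibbs Φ (box (2 * N)) plusC g * F (translate a (fill (box (2 * N)) g plusC))| ≤
        finGibbs Φ (box (2 * N)) plusC g * M := by
    intro g _
    rw [abs_mul, abs_of_nonneg (finGibbs_nonneg _ _ _ _)]
    exact mul_le_mul_of_nonneg_left (hM _) (finGibbs_nonneg _ _ _ _)
  refine (Finset.sum_le_sum this).trans ?_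
  rw [← Finset.sum_mul, finGibbs_sum, one_mul]

lemma GG_translate (Φ : Interaction d) (N : ℕ) (F : Config d → ℝ) (a b : V d) :
    GG Φ N (fun ω => F (translate b ω)) a = GG Φ N F (a + b) := by
  unfold GG
  refine Finset.sum_congr rfl fun g _ => ?_
  congr 1
  change F _ = F _
  congr 1
  funext x
  simp only [translate]
  congr 1
  abel

lemma sum_diff_bound {B B' : Finset (V d)} (h : B ⊆ B') {G : V d → ℝ} {M : ℝ}
    (hM : ∀ a, |G a| ≤ M) :
    |∑ a ∈ B', G a - ∑ a ∈ B, G a| ≤ ((B'.card : ℝ) - B.card) * M := by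
  rw [← Finset.sum_sdiff h, add_sub_cancel_right]
  refine (Finset.abs_sum_le_sum_abs _ _).trans ?_
  refine (Finset.sum_le_sum fun a _ => hM a).trans ?_
  rw [Finset.sum_const, nsmul_eq_mul, Finset.card_sdiff_of_subset h, Nat.cast_sub (Finset.card_le_card h)]

lemma JJ_translate (Φ : Interaction d) {F : Config d → ℝ} {M : ℝ} (hM : ∀ ω, |F ω| ≤ M)
    (b : V d) {k : ℕ} (hb : b ∈ (box k : Finset (V d))) (N : ℕ) :
    |JJ Φ N (fun ω => F (translate b ω)) - JJ Φ N F| ≤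
      2 * M * (((2 * (N + k) + 1 : ℝ) / (2 * N + 1)) ^ d - 1) := by
  unfold JJ
  rw [← mul_sub, abs_mul, abs_of_pos (inv_pos.mpr (box_card_pos N))]
  simp_rw [GG_translate]
  set G := GG Φ N F
  have hG : ∀ a, |G a| ≤ M := GG_bound Φ N hM
  have e1 : ∑ a ∈ (box N : Finset (V d)), G (a + b) =
      ∑ a ∈ (box N : Finset (V d)).map (Equiv.addRight b).toEmbedding, G a := by
    rw [Finset.sum_map]; rfl
  have hsub : (box N : Finset (V d)).map (Equiv.addRight b).toEmbedding ⊆ box (N + k) := by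
    intro y hy
    obtain ⟨x, hx, rfl⟩ := Finset.mem_map.mp hy
    have h1 := mem_box.mp hx
    have h2 := mem_box.mp hb
    rw [mem_box]
    intro c
    have h3 := abs_le.mp (h1 c)
    have h4 := abs_le.mp (h2 c)
    simp only [Equiv.coe_toEmbedding, Equiv.coe_addRight, Pi.add_apply]
    rw [abs_le]
    push_cast
    omega
  have b1 := sum_diff_bound hsub hG
  have b2 := sum_diff_bound (box_mono (d := d) (Nat.le_add_right N k)) hG
  rw [Finset.card_map] at b1
  rw [e1]
  have b3 : |∑ a ∈ (box N : Finset (V d)).map (Equiv.addRight b).toEmbedding, G a -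
      ∑ a ∈ (box N : Finset (V d)), G a| ≤
      2 * M * (((box (N + k) : Finset (V d)).card : ℝ) - (box N : Finset (V d)).card) := by
    rw [abs_le] at b1 b2 ⊢
    constructor <;> linarith [b1.1, b1.2, b2.1, b2.2]
  have hc := box_card_pos (d := d) N
  calc _ ≤ ((box N : Finset (V d)).card : ℝ)⁻¹ *
      (2 * M * (((box (N + k) : Finset (V d)).card : ℝ) - (box N : Finset (V d)).card)) :=
        mul_le_mul_of_nonneg_left b3 (inv_pos.mpr hc).le
    _ = _ := by
        rw [box_card, box_card]
        push_cast
        rw [div_pow]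
        have : ((2 * (N : ℝ) + 1) ^ d) ≠ 0 := by positivity
        field_simp

lemma limit_transInv {Φ : Interaction d}
    {σ : Measure (Config d)} {L : Filter ℕ} (hσ : IsProbabilityMeasure σ) [L.NeBot]
    (hLt : L ≤ atTop)
    (h : ∀ F : Config d → ℝ, Continuous F → Tendsto (fun N => JJ Φ N F) L (𝓝 (∫ ω, F ω ∂σ))) :
    MeasTransInv σ := by
  intro b
  have hm := (continuous_translate b).measurable
  have : IsProbabilityMeasure (σ.map (translate b)) := Measure.isProbabilityMeasure_map hm.aemeasurable
  refine ext_of_forall_integral_eq_of_IsFiniteMeasure fun F => ?_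
  rw [integral_map hm.aemeasurable F.continuous.aestronglyMeasurable]
  have h1 := h _ (F.continuous.comp (continuous_translate b))
  have h2 := h _ F.continuous
  have h3 := h1.sub h2
  obtain ⟨k, hk⟩ := exists_box {b}
  have hb : b ∈ (box k : Finset (V d)) := hk (by simp)
  have hlim : Tendsto (fun N : ℕ => 2 * ‖F‖ * (((2 * ((N : ℝ) + k) + 1 : ℝ) / (2 * N + 1)) ^ d - 1))
      atTop (𝓝 0) := by
    have t1 : Tendsto (fun N : ℕ => (2 * ((N : ℝ) + k) + 1 : ℝ) / (2 * N + 1)) atTop (𝓝 1) := by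
      have t2 : Tendsto (fun N : ℕ => 1 + (2 * (k : ℝ)) / (2 * (N : ℝ) + 1)) atTop (𝓝 (1 + 0)) := by
        refine tendsto_const_nhds.add (Tendsto.const_div_atTop ?_ _)
        exact tendsto_atTop_add_const_right _ _
          (tendsto_natCast_atTop_atTop.const_mul_atTop (by norm_num))
      rw [add_zero] at t2
      refine t2.congr fun N => ?_
      have : (2 * (N : ℝ) + 1) ≠ 0 := by positivity
      field_simp
      ring
    have := ((t1.pow d).sub_const 1).const_mul (2 * ‖F‖)
    simpa using this
  have h4 := squeeze_zero_norm (f := fun N => JJ Φ N (fun ω => F (translate b ω)) - JJ Φ N F)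
    (fun N => JJ_translate Φ (fun ω => F.norm_coe_le_norm ω) b hb N)
    (hlim.mono_left hLt)
  have h5 := tendsto_nhds_unique h3 h4
  exact sub_eq_zero.mp h5

/-! ### Conclusion -/

lemma limit_peierls (hd : 2 ≤ d) (β : ℝ) {Ψ : Interaction d} (hL : IsLocal Ψ) (hT : TransInv Ψ)
    (hF : SpinFlipSymm Ψ) (hDS : DSummable Ψ)
    (hβ : (stepCard d : ℝ) ^ 2 * Real.exp (-(2 * (β - 2 ^ d * dnorm Ψ))) ≤ 1 / 8)
    {σ : Measure (Config d)} {L : Filter ℕ} [L.NeBot]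
    (h : ∀ F : Config d → ℝ, Continuous F →
      Tendsto (fun N => JJ (Iadd (ising β) Ψ) N F) L (𝓝 (∫ ω, F ω ∂σ))) :
    ∫ ω : Config d, (if ω 0 = false then (1 : ℝ) else 0) ∂σ ≤ 1 / 3 := by
  have hc : Continuous (fun ω : Config d => if ω 0 = false then (1 : ℝ) else 0) :=
    (continuous_of_discreteTopology (f := fun b : Bool => if b = false then (1 : ℝ) else 0)).comp
      (continuous_apply 0)
  refine le_of_tendsto (h _ hc) (Eventually.of_forall fun N => ?_)
  unfold JJ
  have hb : ∀ a ∈ (box N : Finset (V d)), GG (Iadd (ising β) Ψ) N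
      (fun ω : Config d => if ω 0 = false then (1 : ℝ) else 0) a ≤ 1 / 3 := by
    intro a _
    have := peierls hd β hL hT hF hDS hβ (2 * N) a
    unfold GG
    simp only [translate, zero_add]
    convert this using 3
  have hs := Finset.sum_le_sum hb
  rw [Finset.sum_const, nsmul_eq_mul] at hs
  have hp := box_card_pos (d := d) N
  rw [inv_mul_le_iff₀ hp]
  exact hs

lemma gibbs_flip {Φ : Interaction d} (hF : SpinFlipSymm Φ) (hL : IsLocal Φ) (hT : TransInv Φ)
    (hS : AbsSummable Φ) {σ : Measure (Config d)}
    (hσ : ∀ (Δ : Finset (V d)) (f : ↥Δ → Bool), (σ (cyl Δ f)).toReal = ∫ η, finGibbs Φ Δ η f ∂σ)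
    (Δ : Finset (V d)) (f : ↥Δ → Bool) :
    ((σ.map gflip) (cyl Δ f)).toReal = ∫ η, finGibbs Φ Δ η f ∂(σ.map gflip) := by
  have hm : Measurable (gflip : Config d → Config d) := continuous_gflip.measurable
  rw [integral_map hm.aemeasurable (continuous_finGibbs hL hT hS Δ f).aestronglyMeasurable,
    Measure.map_apply hm (measurable_cyl Δ f)]
  have e1 : gflip ⁻¹' (cyl Δ f) =
      cyl (Δ.map (Equiv.refl (V d)).toEmbedding) (symmE true (Equiv.refl _) Δ f) := by
    ext ω
    rw [Set.mem_preimage, gflip_symm, symm_cyl]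
  rw [e1, hσ]
  congr 1
  funext η
  rw [gflip_symm, symm_finGibbs (flip_symm hF)]

lemma transInv_flip {σ : Measure (Config d)} (hσ : MeasTransInv σ) :
    MeasTransInv (σ.map gflip) := by
  intro a
  have hm : Measurable (gflip : Config d → Config d) := continuous_gflip.measurable
  have hm' : Measurable (translate a : Config d → Config d) := (continuous_translate a).measurable
  rw [Measure.map_map hm' hm]
  have : translate a ∘ (gflip : Config d → Config d) = gflip ∘ translate a := rfl
  rw [this, ← Measure.map_map hm hm', hσ a]

lemma flip_ne {σ : Measure (Config d)} (hσ : IsProbabilityMeasure σ)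
    (h : ∫ ω : Config d, (if ω 0 = false then (1 : ℝ) else 0) ∂σ ≤ 1 / 3) :
    σ ≠ σ.map gflip := by
  intro heq
  have hm : Measurable (gflip : Config d → Config d) := continuous_gflip.measurable
  have hc : Continuous (fun ω : Config d => if ω 0 = false then (1 : ℝ) else 0) :=
    (continuous_of_discreteTopology (f := fun b : Bool => if b = false then (1 : ℝ) else 0)).comp
      (continuous_apply 0)
  have h2 : ∫ ω : Config d, (if gflip ω 0 = false then (1 : ℝ) else 0) ∂σ ≤ 1 / 3 := by
    rw [heq, integral_map hm.aemeasurable hc.aestronglyMeasurable] at h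
    exact h
  have hs : ∫ ω : Config d, ((if ω 0 = false then (1 : ℝ) else 0) +
      (if gflip ω 0 = false then (1 : ℝ) else 0)) ∂σ = 1 := by
    have : (fun ω : Config d => (if ω 0 = false then (1 : ℝ) else 0) +
      (if gflip ω 0 = false then (1 : ℝ) else 0)) = fun _ => 1 := by
      funext ω
      cases hω : ω 0 <;> simp [gflip, hω]
    rw [this]
    simp
  have hc2 : Continuous (fun ω : Config d => if gflip ω 0 = false then (1 : ℝ) else 0) :=
    hc.comp continuous_gflip
  rw [integral_add (integrable_of_continuous σ hc)
    (integrable_of_continuous σ hc2)] at hs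
  linarith

/-- There exist `β_l > 0` and `δ > 0` such that for every `β ≥ β_l` and every
translation invariant, spin-flip symmetric interaction `Ψ` with `|||Ψ||| < δ`, the
interaction `Φ = Φ^β + Ψ` has at least two distinct translation-invariant Gibbs states. -/
theorem coexistence_low_temperature (d : ℕ) (hd : 2 ≤ d) :
    ∃ βl > (0:ℝ), ∃ δ > (0:ℝ), ∀ β : ℝ, βl ≤ β →
      ∀ Ψ : Interaction d, IsLocal Ψ → TransInv Ψ → SpinFlipSymm Ψ →
        DSummable Ψ → dnorm Ψ < δ →
        ∃ σ₁ σ₂ : Measure (Config d), σ₁ ≠ σ₂ ∧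
          IsGibbs (Iadd (ising β) Ψ) σ₁ ∧ MeasTransInv σ₁ ∧
          IsGibbs (Iadd (ising β) Ψ) σ₂ ∧ MeasTransInv σ₂ := by
  have hC1 : (1 : ℝ) ≤ stepCard d := by
    unfold stepCard
    have : Nonempty ((Fin d → Fin 3) × Fin d) := ⟨(fun _ => 0, ⟨0, by omega⟩)⟩
    exact_mod_cast Fintype.card_pos
  have hlog : 0 ≤ Real.log (8 * (stepCard d : ℝ) ^ 2) := by
    apply Real.log_nonneg
    nlinarith
  refine ⟨2 ^ d + Real.log (8 * (stepCard d : ℝ) ^ 2), by positivity, 1, one_pos, ?_⟩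
  intro β hβ Ψ hL hT hF hDS hδ
  have hkey : (stepCard d : ℝ) ^ 2 * Real.exp (-(2 * (β - 2 ^ d * dnorm Ψ))) ≤ 1 / 8 := by
    have h1 : Real.log (8 * (stepCard d : ℝ) ^ 2) ≤ 2 * (β - 2 ^ d * dnorm Ψ) := by
      have : (2 : ℝ) ^ d * dnorm Ψ ≤ 2 ^ d * 1 := by gcongr
      linarith
    have h2 : Real.exp (-(2 * (β - 2 ^ d * dnorm Ψ))) ≤ (8 * (stepCard d : ℝ) ^ 2)⁻¹ := by
      rw [Real.exp_neg]
      apply inv_anti₀ (by positivity)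
      rw [← Real.log_le_iff_le_exp (by positivity)]
      exact h1
    calc _ ≤ (stepCard d : ℝ) ^ 2 * (8 * (stepCard d : ℝ) ^ 2)⁻¹ := by gcongr
      _ = 1 / 8 := by
        have : (stepCard d : ℝ) ≠ 0 := by positivity
        field_simp
  have hLΦ := iadd_local (ising_local (d := d) β) hL
  have hTΦ := iadd_transInv (ising_transInv (d := d) β) hT
  have hFΦ := iadd_flip (ising_flip (d := d) β) hF
  have hSΦ := iadd_absSummable (ising_local (d := d) β) hL (ising_absSummable β)
    (absSummable_of_dSummable hDS)
  obtain ⟨σ, L, hσ, hNe, hLt, hlim⟩ := exists_limit (Iadd (ising β) Ψ)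
  have hm : Measurable (gflip : Config d → Config d) := continuous_gflip.measurable
  have hG := limit_gibbs hLΦ hTΦ hSΦ hσ hLt hlim
  have hI := limit_transInv hσ hLt hlim
  have hP : IsProbabilityMeasure (σ.map gflip) := Measure.isProbabilityMeasure_map hm.aemeasurable
  exact ⟨σ, σ.map gflip, flip_ne hσ (limit_peierls hd β hL hT hF hDS hkey hlim),
    ⟨hσ, fun Λ => ⟨σ, hσ, hG Λ⟩⟩, hI,
    ⟨hP, fun Λ => ⟨_, hP, gibbs_flip hFΦ hLΦ hTΦ hSΦ hG Λ⟩⟩, transInv_flip hI⟩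

end
end Ising
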